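/- arXiv:1207.2393 — 3 statements merged into one kernel-verified Lean document; each statement's English description precedes it below -/
import Mathlib

section
/- Let n and k be integers with 0 ≤ k ≤ n − 2. Among all finite simple graphs with n vertices and exactly k cut vertices, the Harary index is maximized by G_{n,k}, and G_{n,k} is the unique maximizer up to isomorphism: every graph G on n vertices with exactly k cut vertices satisfies H(G) ≤ H(G_{n,k}), with equality if and only if G is isomorphic to G_{n,k}. -/
open SimpleGraph

/-- The Harary index of a finite simple graph: sum of reciprocals of distances over
unordered pairs of distinct vertices (pairs at infinite distance contribute `0`,
since `SimpleGraph.dist` is `0` there and `1/0 = 0` in `ℝ`). -/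
noncomputable def hararyIndex {V : Type*} [Fintype V] (G : SimpleGraph V) : ℝ :=
  (∑ u : V, ∑ v : V, (1 : ℝ) / (G.dist u v)) / 2

/-- The clique vertex "owning" vertex `j` of `GNK n k`: the first `n - k` vertices form
the clique `K_{n-k}`, and the remaining `k` vertices are distributed round-robin among
the clique vertices, forming pendant paths of almost equal lengths. -/
def gnkOwner (n k j : ℕ) : ℕ := if j < n - k then j else (j - (n - k)) % (n - k)

/-- The distance of vertex `j` of `GNK n k` from its owning clique vertex along the
attached pendant path. -/
def gnkDepth (n k j : ℕ) : ℕ := if j < n - k then 0 else (j - (n - k)) / (n - k) + 1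

/-- The graph `G_{n,k}` on `n` vertices: obtained from `K_{n-k}` by attaching pendant
paths of almost equal lengths (`k` new vertices in total, distributed round-robin) at
its `n - k` vertices. -/
def GNK (n k : ℕ) : SimpleGraph (Fin n) :=
  SimpleGraph.fromRel (fun a b =>
    (gnkDepth n k a = 0 ∧ gnkDepth n k b = 0) ∨
    (gnkOwner n k a = gnkOwner n k b ∧ gnkDepth n k a + 1 = gnkDepth n k b))

/-- A vertex is a cut vertex if deleting it increases the number of connected
components. -/
def IsCutVertex {V : Type*} [Fintype V] (G : SimpleGraph V) (v : V) : Prop :=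
  Nat.card G.ConnectedComponent <
    Nat.card (G.induce ({v}ᶜ : Set V)).ConnectedComponent


/-! ### Arithmetic of legs -/

/-- geometric sum `1 + t + ... + t^(n-1)` -/
def hA (t : ℝ) : ℕ → ℝ
  | 0 => 0
  | n + 1 => 1 + t * hA t n

/-- pair sum of a path on `n` vertices -/
def hI (t : ℝ) : ℕ → ℝ
  | 0 => 0
  | n + 1 => hI t n + t * hA t n

def sA (t : ℝ) (L : List ℕ) : ℝ := (L.map (hA t)).sum

/-- pair sum of a clique with legs of lengths `L` -/
def hV (t : ℝ) : List ℕ → ℝ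
  | [] => 0
  | a :: L => hI t a + hV t L + t * hA t a * sA t L

@[simp] lemma sA_nil (t : ℝ) : sA t [] = 0 := rfl
@[simp] lemma sA_cons (t : ℝ) (a : ℕ) (L : List ℕ) : sA t (a :: L) = hA t a + sA t L := by
  simp [sA]
@[simp] lemma sA_append (t : ℝ) (L M : List ℕ) : sA t (L ++ M) = sA t L + sA t M := by
  simp [sA]

lemma sA_perm (t : ℝ) {L M : List ℕ} (h : L.Perm M) : sA t L = sA t M :=
  (h.map _).sum_eq

lemma hV_append (t : ℝ) (L M : List ℕ) :
    hV t (L ++ M) = hV t L + hV t M + t * sA t L * sA t M := by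
  induction L with
  | nil => simp [hV]
  | cons a L ih => simp only [List.cons_append, hV, ih, sA_append, sA_cons]; ring

lemma hV_perm (t : ℝ) {L M : List ℕ} (h : L.Perm M) : hV t L = hV t M := by
  induction h with
  | nil => rfl
  | cons a h ih => simp only [hV, ih, sA_perm t h]
  | swap a b L => simp only [hV, sA_cons]; ring
  | trans _ _ h1 h2 => exact h1.trans h2

lemma hA_add (t : ℝ) (a b : ℕ) : hA t (a + b) = hA t a + t ^ a * hA t b := by
  induction a with
  | zero => simp [hA]
  | succ a ih => rw [Nat.succ_add]; simp only [hA, ih]; ring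

lemma hA_one (t : ℝ) : hA t 1 = 1 := by simp [hA]

lemma hA_succ' (t : ℝ) (a : ℕ) : hA t (a + 1) = hA t a + t ^ a := by
  rw [hA_add, hA_one, mul_one]

lemma hI_add (t : ℝ) (a b : ℕ) :
    hI t (a + b) = hI t a + hI t b + t * hA t a * hA t b := by
  induction b with
  | zero => simp [hA, hI]
  | succ b ih =>
    rw [← add_assoc]; simp only [hI, ih, hA_add, hA_succ' t b]
    have := hA_succ' t a
    simp only [hA] at this
    have h2 : hA t b * (1 - t) = 1 - t ^ b := by
      clear ih this
      induction b with
      | zero => simp [hA]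
      | succ b ih => rw [hA_succ', add_mul, ih]; ring
    have h3 : t * hA t a = hA t a + t ^ a - 1 := by linarith
    have h4 : t ^ b = 1 - hA t b * (1 - t) := by linarith
    rw [h4]
    linear_combination (-hA t b * t) * h3

lemma hI_one (t : ℝ) : hI t 1 = 0 := by simp [hI, hA]

lemma hA_nonneg {t : ℝ} (ht : 0 < t) (n : ℕ) : 0 ≤ hA t n := by
  induction n with
  | zero => simp [hA]
  | succ n ih => simp only [hA]; positivity

lemma hA_pos {t : ℝ} (ht : 0 < t) {n : ℕ} (hn : 0 < n) : 0 < hA t n := by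
  obtain ⟨m, rfl⟩ : ∃ m, n = m + 1 := ⟨n - 1, by omega⟩
  have := hA_nonneg ht m
  simp only [hA]; positivity

lemma sA_nonneg {t : ℝ} (ht : 0 < t) (L : List ℕ) : 0 ≤ sA t L := by
  induction L with
  | nil => simp
  | cons a L ih => have := hA_nonneg ht a; simp; positivity

lemma sA_pos {t : ℝ} (ht : 0 < t) {L : List ℕ} {a : ℕ} (ha : a ∈ L) (h0 : 0 < a) :
    0 < sA t L := by
  rw [sA_perm t (List.perm_cons_erase ha), sA_cons]
  have := hA_pos ht h0
  have := sA_nonneg ht (L.erase a)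
  positivity

lemma hV_two (t : ℝ) (a b : ℕ) (L : List ℕ) :
    hV t (a :: b :: L) = hI t (a + b) + hV t L + t * (hA t a + hA t b) * sA t L := by
  simp only [hV, sA_cons, hI_add]; ring

lemma hV_move {t : ℝ} (a b : ℕ) (L : List ℕ) :
    hV t (a :: (b + 1) :: L) - hV t ((a + 1) :: b :: L) = t * (t ^ b - t ^ a) * sA t L := by
  rw [hV_two, hV_two, hA_succ', hA_succ', show a + (b + 1) = a + 1 + b by ring]
  ring

def LBal (L : List ℕ) : Prop := ∀ a ∈ L, ∀ b ∈ L, a ≤ b + 1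

lemma sum_le_of_forall (L : List ℕ) (m : ℕ) (h : ∀ x ∈ L, x ≤ m) : L.sum ≤ L.length * m := by
  induction L with
  | nil => simp
  | cons a L ih =>
    simp only [List.sum_cons, List.length_cons]
    have := h a (by simp)
    have := ih (fun x hx => h x (by simp [hx]))
    rw [Nat.add_mul]; omega

lemma le_sum_of_forall (L : List ℕ) (m : ℕ) (h : ∀ x ∈ L, m ≤ x) : L.length * m ≤ L.sum := by
  induction L with
  | nil => simp
  | cons a L ih =>
    simp only [List.sum_cons, List.length_cons]
    have := h a (by simp)
    have := ih (fun x hx => h x (by simp [hx]))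
    rw [Nat.add_mul]; omega

lemma bal_mem {L : List ℕ} (hL : LBal L) {a : ℕ} (ha : a ∈ L) :
    a = L.sum / L.length ∨ a = L.sum / L.length + 1 := by
  have hp := List.perm_cons_erase ha
  have hs := hp.sum_eq
  have hl := hp.length_eq
  set M := L.erase a
  simp only [List.sum_cons, List.length_cons] at hs hl
  have hM : ∀ x ∈ M, x ∈ L := fun x hx => List.mem_of_mem_erase hx
  have h1 := sum_le_of_forall M (a + 1) (fun x hx => hL _ (hM x hx) _ ha)
  have h2 := le_sum_of_forall M (a - 1) (fun x hx => by have := hL _ ha _ (hM x hx); omega)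
  rw [hs, hl]
  have h3 : (a + M.sum) / (M.length + 1) < a + 1 := by
    rw [Nat.div_lt_iff_lt_mul (by omega)]
    nlinarith
  have h4 : a - 1 ≤ (a + M.sum) / (M.length + 1) := by
    rw [Nat.le_div_iff_mul_le (by omega)]
    rw [Nat.mul_add, Nat.mul_comm]; omega
  omega

lemma two_val {L : List ℕ} {q : ℕ} (h : ∀ a ∈ L, a = q ∨ a = q + 1) :
    L.sum = q * L.length + L.count (q + 1) ∧ L.length = L.count q + L.count (q + 1) := by
  induction L with
  | nil => simp
  | cons a L ih =>
    obtain ⟨h1, h2⟩ := ih (fun x hx => h x (by simp [hx]))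
    rcases h a (by simp) with rfl | rfl
    · simp [h1]; constructor <;> [ring; omega]
    · simp [h1]; constructor <;> [ring; omega]

lemma bal_perm {L M : List ℕ} (hL : LBal L) (hM : LBal M) (hl : L.length = M.length)
    (hs : L.sum = M.sum) : L.Perm M := by
  have h1 : ∀ a ∈ L, _ := fun a ha => bal_mem hL ha
  have h2 : ∀ a ∈ M, _ := fun a ha => bal_mem hM ha
  rw [← hs, ← hl] at h2
  have h3 := two_val h1
  have h4 := two_val h2
  rw [List.perm_iff_count]
  intro x
  set q := L.sum / L.length
  rw [← hl] at h4
  by_cases hx : x = q + 1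
  · subst hx; omega
  by_cases hx' : x = q
  · subst hx'; omega
  rw [List.count_eq_zero_of_not_mem, List.count_eq_zero_of_not_mem]
  · intro h; have := h2 x h; omega
  · intro h; have := h1 x h; omega

lemma exists_unbal {L : List ℕ} (h : ¬ LBal L) :
    ∃ a b M, b + 2 ≤ a + 1 ∧ L.Perm ((a + 1) :: b :: M) := by
  simp only [LBal, not_forall, not_le] at h
  obtain ⟨a, ha, b, hb, hab⟩ := h
  have h1 := List.perm_cons_erase ha
  have hb' : b ∈ L.erase a := (List.mem_erase_of_ne (by omega)).2 hb
  refine ⟨a - 1, b, (L.erase a).erase b, by omega, ?_⟩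
  rw [show a - 1 + 1 = a by omega]
  exact h1.trans ((List.perm_cons_erase hb').cons _)

lemma hV_le_bal {t : ℝ} (ht : 0 < t) (ht1 : t < 1) {M : List ℕ} (hM : LBal M) :
    ∀ (N : ℕ) (L : List ℕ), (L.map (fun x => x * x)).sum ≤ N → L.length = M.length →
      L.sum = M.sum → hV t L ≤ hV t M := by
  intro N
  induction N with
  | zero =>
    intro L hN hl hs
    by_cases hb : LBal L
    · exact (hV_perm t (bal_perm hb hM hl hs)).le
    · obtain ⟨a, b, K, hab, hp⟩ := exists_unbal hb
      have := (hp.map (fun x => x * x)).sum_eq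
      simp at this
      have : 0 < (a + 1) * (a + 1) := by positivity
      omega
  | succ N ih =>
    intro L hN hl hs
    by_cases hb : LBal L
    · exact (hV_perm t (bal_perm hb hM hl hs)).le
    · obtain ⟨a, b, K, hab, hp⟩ := exists_unbal hb
      have h1 := (hp.map (fun x => x * x)).sum_eq
      rw [hV_perm t hp]
      have h2 := hV_move (t := t) a b K
      have h3 : t ^ a ≤ t ^ b := pow_le_pow_of_le_one ht.le ht1.le (by omega)
      have h4 : 0 ≤ t * (t ^ b - t ^ a) * sA t K :=
        mul_nonneg (mul_nonneg ht.le (by linarith)) (sA_nonneg ht K)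
      have h5 := ih (a :: (b + 1) :: K) (by
          simp only [List.map_cons, List.sum_cons] at h1 ⊢
          rw [h1] at hN
          nlinarith) (by rw [← hl, hp.length_eq]; simp) (by
          rw [← hs, hp.sum_eq]; simp; ring)
      linarith

lemma hV_lt_bal {t : ℝ} (ht : 0 < t) (ht1 : t < 1) {M : List ℕ} (hM : LBal M) (L : List ℕ)
    (hl : L.length = M.length) (hs : L.sum = M.sum) (h3 : 3 ≤ L.length)
    (hpos : 2 ≤ L.countP (fun x => decide (0 < x))) (hb : ¬ LBal L) : hV t L < hV t M := by
  have key : ∀ a b K, b + 2 ≤ a + 1 → L.Perm ((a + 1) :: b :: K) → 0 < sA t K →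
      hV t L < hV t M := by
    intro a b K hab hp hK
    rw [hV_perm t hp]
    have h2 := hV_move (t := t) a b K
    have h3 : t ^ a < t ^ b := pow_lt_pow_right_of_lt_one₀ ht ht1 (by omega)
    have h4 : 0 < t * (t ^ b - t ^ a) * sA t K :=
      mul_pos (mul_pos ht (by linarith)) hK
    have h5 := hV_le_bal ht ht1 hM _ (a :: (b + 1) :: K) le_rfl
      (by rw [← hl, hp.length_eq]; simp) (by rw [← hs, hp.sum_eq]; simp; ring)
    linarith
  obtain ⟨a, b, K, hab, hp⟩ := exists_unbal hb
  by_cases hK : ∃ x ∈ K, 0 < x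
  · obtain ⟨x, hx, h0⟩ := hK
    exact key a b K hab hp (sA_pos ht hx h0)
  · push Not at hK
    have hc := hp.countP_eq (fun x => decide (0 < x))
    have hK0 : K.countP (fun x => decide (0 < x)) = 0 := by
      rw [List.countP_eq_zero]; intro x hx; have := hK x hx; simp; omega
    simp only [List.countP_cons, hK0] at hc
    have hb0 : 0 < b := by
      by_contra h
      simp [h] at hc; omega
    have hlen := hp.length_eq
    match K, hK, hp, hlen with
    | [], _, _, hlen => simp at hlen; omega
    | z :: K', hK, hp, _ =>
      have hz : z = 0 := by have := hK z (by simp); omega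
      subst hz
      refine key a 0 (b :: K') (by omega) (hp.trans ?_) (sA_pos ht (a := b) (by simp) hb0)
      exact (List.Perm.swap _ _ _).cons _

/-! ### Forests -/

inductive Fo (V : Type*) where
  | nil : Fo V
  | node (a : V) (C R : Fo V) : Fo V

namespace Fo

variable {V : Type*}

def A (t : ℝ) : Fo V → ℝ
  | nil => 0
  | node _ C R => 1 + t * A t C + A t R

def W (t : ℝ) : Fo V → ℝ
  | nil => 0
  | node _ C R => W t C + W t R + t * A t C + t * (1 + t * A t C) * A t R

def size : Fo V → ℕ
  | nil => 0
  | node _ C R => 1 + size C + size R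

def leaves : Fo V → ℕ
  | nil => 0
  | node _ C R => max (leaves C) 1 + leaves R

def labels : Fo V → List V
  | nil => []
  | node a C R => a :: (labels C ++ labels R)

def roots : Fo V → List V
  | nil => []
  | node a _ R => a :: roots R

def path : List V → Fo V
  | [] => nil
  | a :: l => node a (path l) nil

def legs : List (List V) → Fo V
  | [] => nil
  | [] :: ls => legs ls
  | (a :: l) :: ls => node a (path l) (legs ls)

def broom : List V → List (List V) → Fo V
  | [], ls => legs ls
  | a :: st, ls => node a (broom st ls) nil

lemma legs_single (l : List V) : legs [l] = path l := by
  cases l <;> rfl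

lemma leaves_pos {T : Fo V} (h : T ≠ nil) : 0 < leaves T := by
  cases T with
  | nil => exact absurd rfl h
  | node a C R => simp only [leaves]; omega

lemma A_nonneg {t : ℝ} (ht : 0 < t) (T : Fo V) : 0 ≤ A t T := by
  induction T with
  | nil => simp [A]
  | node a C R h1 h2 => simp only [A]; positivity

end Fo

def bA (t : ℝ) (s : ℕ) (L : List ℕ) : ℝ := hA t s + t ^ s * sA t L
def bW (t : ℝ) (s : ℕ) (L : List ℕ) : ℝ := hI t s + hV t L + t * hA t s * sA t L

def LValid (s : ℕ) (L : List ℕ) : Prop :=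
  0 < L.length ∧ (∀ x ∈ L, 0 < x) ∧ (L.length = 1 → s = 0)

lemma bA_nonneg {t : ℝ} (ht : 0 < t) (s : ℕ) (L : List ℕ) : 0 ≤ bA t s L := by
  have := hA_nonneg ht s
  have := sA_nonneg ht L
  unfold bA; positivity

/-- the basic transformation: a stem `s` with legs `L` next to siblings of total mass `y`
and pair sum `w`, below external mass `l`. -/
lemma trans_basic {t : ℝ} (ht : 0 < t) (ht1 : t < 1) {s : ℕ} {L : List ℕ} (hs : 0 < s)
    (hv : LValid s L) (y w l : ℝ) (hy : 0 < y) :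
    (∃ L', L'.length = L.length ∧ L'.sum = s + L.sum ∧ (∀ x ∈ L', 0 < x) ∧
      bW t s L + w + t * bA t s L * y + t * l * (bA t s L + y) <
        hV t L' + w + t * sA t L' * y + t * l * (sA t L' + y)) ∨
    (bW t s L + w + t * bA t s L * y + t * l * (bA t s L + y) <
      hI t s + (hV t L + w + t * sA t L * y) + t * hA t s * (sA t L + y) +
        t * l * (hA t s + t ^ s * (sA t L + y))) := by
  obtain ⟨h0, hpos, h1⟩ := hv
  have hlen : L.length ≠ 1 := fun h => by have := h1 h; omega
  have hts : 0 < 1 - t ^ s := by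
    have := pow_lt_one₀ ht.le ht1 (n := s) (by omega)
    linarith
  by_cases hl : l < sA t L
  · right
    have : 0 < t * y * (1 - t ^ s) * (sA t L - l) := by
      have : 0 < sA t L - l := by linarith
      positivity
    simp only [bW, bA]
    nlinarith
  · left
    match L, h0, hpos, hlen, hl with
    | x :: z :: K, _, hpos, _, hl =>
      refine ⟨(s + x) :: z :: K, by simp, by simp; ring, ?_, ?_⟩
      · intro u hu
        rcases List.mem_cons.1 hu with rfl | hu
        · omega
        · exact hpos u (List.mem_cons_of_mem _ hu)
      · set M := z :: K with hM
        have hMpos : 0 < sA t M := sA_pos ht (a := z) (by simp [hM]) (hpos z (by simp [hM]))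
        have hx : 0 < l + y - hA t x := by
          rw [sA_cons] at hl; linarith
        have : 0 < t * (1 - t ^ s) * sA t M * (l + y - hA t x) := by positivity
        simp only [bW, bA, hV, sA_cons, hI_add, hA_add]
        nlinarith
    | [_], _, _, h, _ => simp at h

lemma bW_stem (t : ℝ) (s s' : ℕ) (L : List ℕ) (l : ℝ) :
    bW t (s + s') L + t * l * bA t (s + s') L =
      hI t s + t * hA t s * bA t s' L + bW t s' L + t * l * (hA t s + t ^ s * bA t s' L) := by
  have h := hA_add t s s'
  rw [add_comm s s', hA_add] at h
  simp only [bW, bA, hI_add, hA_add, pow_add]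
  linear_combination (-t * sA t L) * h

lemma comb {t : ℝ} (ht : 0 < t) (ht1 : t < 1) {s₁ s₂ : ℕ} {L₁ L₂ : List ℕ}
    (h1 : LValid s₁ L₁) (h2 : LValid s₂ L₂) (l : ℝ) :
    ∃ s L, L.length = L₁.length + L₂.length ∧ s + L.sum = s₁ + L₁.sum + (s₂ + L₂.sum) ∧
      LValid s L ∧
      ((s₁ = 0 ∧ s₂ = 0 ∧ s = 0 ∧ L = L₁ ++ L₂ ∧
        bW t s₁ L₁ + bW t s₂ L₂ + t * bA t s₁ L₁ * bA t s₂ L₂ + t * l * (bA t s₁ L₁ + bA t s₂ L₂)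
          = bW t s L + t * l * bA t s L) ∨
        bW t s₁ L₁ + bW t s₂ L₂ + t * bA t s₁ L₁ * bA t s₂ L₂ + t * l * (bA t s₁ L₁ + bA t s₂ L₂)
          < bW t s L + t * l * bA t s L) := by
  -- one broom and one bunch of legs
  have half : ∀ (s : ℕ) (L M : List ℕ) (l : ℝ), 0 < s → LValid s L → 0 < M.length →
      (∀ x ∈ M, 0 < x) → ∃ s' L', L'.length = L.length + M.length ∧
        s' + L'.sum = s + L.sum + M.sum ∧ LValid s' L' ∧
        bW t s L + hV t M + t * bA t s L * sA t M + t * l * (bA t s L + sA t M)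
          < bW t s' L' + t * l * bA t s' L' := by
    intro s L M l hs hv hM hMp
    have hMpos : 0 < sA t M := by
      obtain ⟨z, hz⟩ := List.exists_mem_of_length_pos hM
      exact sA_pos ht hz (hMp z hz)
    have hL0 := hv.1
    rcases trans_basic ht ht1 hs hv (sA t M) (hV t M) l hMpos with ⟨L', e1, e2, e3, e4⟩ | e4
    · refine ⟨0, L' ++ M, by simp [e1], by simp [e2], ⟨by simp; omega, ?_, fun _ => rfl⟩, ?_⟩
      · intro x hx
        rcases List.mem_append.1 hx with h | h
        exacts [e3 x h, hMp x h]
      · refine e4.trans_eq ?_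
        simp only [bW, bA, hV_append, sA_append, hI, hA]; ring
    · refine ⟨s, L ++ M, by simp, by simp; ring, ⟨by simp; omega, ?_, ?_⟩, ?_⟩
      · intro x hx
        rcases List.mem_append.1 hx with h | h
        exacts [hv.2.1 x h, hMp x h]
      · intro h; simp at h; omega
      · refine e4.trans_eq ?_
        simp only [bW, bA, hV_append, sA_append]
  have h10 := h1.1
  have h20 := h2.1
  by_cases hs1 : s₁ = 0
  · by_cases hs2 : s₂ = 0
    · subst hs1 hs2
      refine ⟨0, L₁ ++ L₂, by simp, by simp, ⟨by simp; omega, ?_, fun _ => rfl⟩,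
        Or.inl ⟨rfl, rfl, rfl, rfl, ?_⟩⟩
      · intro x hx
        rcases List.mem_append.1 hx with h | h
        exacts [h1.2.1 x h, h2.2.1 x h]
      · simp only [bW, bA, hV_append, sA_append, hI, hA]; ring
    · subst hs1
      obtain ⟨s', L', e1, e2, e3, e4⟩ := half s₂ L₂ L₁ l (by omega) h2 h10 h1.2.1
      refine ⟨s', L', by omega, by omega, e3, Or.inr (lt_of_eq_of_lt ?_ e4)⟩
      have e5 : bW t 0 L₁ = hV t L₁ := by simp [bW, hI, hA]
      have e6 : bA t 0 L₁ = sA t L₁ := by simp [bA, hA]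
      rw [e5, e6]; ring
  · by_cases hs2 : s₂ = 0
    · subst hs2
      obtain ⟨s', L', e1, e2, e3, e4⟩ := half s₁ L₁ L₂ l (by omega) h1 h20 h2.2.1
      refine ⟨s', L', by omega, by omega, e3, Or.inr (lt_of_eq_of_lt ?_ e4)⟩
      have e5 : bW t 0 L₂ = hV t L₂ := by simp [bW, hI, hA]
      have e6 : bA t 0 L₂ = sA t L₂ := by simp [bA, hA]
      rw [e5, e6]
    · have hy : 0 < bA t s₂ L₂ := by
        have := hA_pos ht (n := s₂) (by omega)
        have := sA_nonneg ht L₂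
        unfold bA; positivity
      rcases trans_basic ht ht1 (by omega) h1 (bA t s₂ L₂) (bW t s₂ L₂) l hy with
        ⟨L', e1, e2, e3, e4⟩ | e4
      · obtain ⟨s', M, f1, f2, f3, f4⟩ := half s₂ L₂ L' l (by omega) h2 (by omega) e3
        refine ⟨s', M, by omega, by omega, f3, Or.inr (e4.trans ?_)⟩
        refine lt_of_eq_of_lt ?_ f4
        ring
      · obtain ⟨s', M, f1, f2, f3, f4⟩ :=
          half s₂ L₂ L₁ (hA t s₁ + t ^ s₁ * l) (by omega) h2 h10 h1.2.1
        refine ⟨s₁ + s', M, by omega, by omega, ⟨f3.1, f3.2.1, ?_⟩, Or.inr (e4.trans ?_)⟩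
        · intro h; omega
        · rw [bW_stem]
          linarith

def FRes {V : Type*} (t l : ℝ) (T : Fo V) : Prop :=
  ∃ s L, L.length = T.leaves ∧ s + L.sum = T.size ∧ LValid s L ∧
    ((T.W t + t * l * T.A t < bW t s L + t * l * bA t s L) ∨
      ((T.W t + t * l * T.A t = bW t s L + t * l * bA t s L) ∧
        ∃ st ls, T = Fo.broom st ls ∧ st.length = s ∧ ls.map List.length = L))

lemma forest_opt {V : Type*} {t : ℝ} (ht : 0 < t) (ht1 : t < 1) (T : Fo V) :
    ∀ l : ℝ, T ≠ Fo.nil → FRes t l T := by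
  induction T with
  | nil => intro l h; exact absurd rfl h
  | node a C R ihC ihR =>
    intro l _
    -- the first branch
    have hbr : ∃ s L, L.length = max C.leaves 1 ∧ s + L.sum = 1 + C.size ∧ LValid s L ∧
        ((C.W t + t * C.A t + t * (l + R.A t) * (1 + t * C.A t) <
            bW t s L + t * (l + R.A t) * bA t s L) ∨
          ((C.W t + t * C.A t + t * (l + R.A t) * (1 + t * C.A t) =
            bW t s L + t * (l + R.A t) * bA t s L) ∧
           ((s = 0 ∧ ∃ p, C = Fo.path p ∧ L = [p.length + 1]) ∨
            (∃ st ls, C = Fo.broom st ls ∧ st.length + 1 = s ∧ ls.map List.length = L)))) := by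
      by_cases hC : C = Fo.nil
      · subst hC
        refine ⟨0, [1], by simp [Fo.leaves], by simp [Fo.size], ⟨by simp, by simp, fun _ => rfl⟩,
          Or.inr ⟨?_, Or.inl ⟨rfl, [], rfl, rfl⟩⟩⟩
        simp [Fo.W, Fo.A, bW, bA, hV, hI, hA]
      · obtain ⟨s, L, e1, e2, e3, e4⟩ := ihC (1 + t * (l + R.A t)) hC
        have hlp := Fo.leaves_pos hC
        by_cases hL1 : L.length = 1
        · have hs := e3.2.2 hL1
          subst hs
          obtain ⟨x, rfl⟩ := List.length_eq_one_iff.1 hL1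
          refine ⟨0, [x + 1], by simp at e1 ⊢; omega, by simp at e2 ⊢; omega,
            ⟨by simp, by simp, fun _ => rfl⟩, ?_⟩
          have hx : bW t 0 [x + 1] + t * (l + R.A t) * bA t 0 [x + 1] =
              bW t 0 [x] + t * (1 + t * (l + R.A t)) * bA t 0 [x] + t * (l + R.A t) := by
            simp [bW, bA, hV, hI, hA]; ring
          rw [hx]
          rcases e4 with e4 | ⟨e4, st, ls, e5, e6, e7⟩
          · left; nlinarith
          · right
            refine ⟨by linear_combination e4, Or.inl ⟨rfl, ?_⟩⟩
            have : st = [] := List.length_eq_zero_iff.1 e6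
            subst this
            obtain ⟨p, rfl⟩ : ∃ p, ls = [p] := by
              rw [← List.length_eq_one_iff, ← List.length_map (f := List.length), e7]; rfl
            refine ⟨p, ?_, ?_⟩
            · rw [e5, Fo.broom, Fo.legs_single]
            · simp at e7; simp [e7]
        · refine ⟨s + 1, L, by omega, by omega, ⟨e3.1, e3.2.1, fun h => absurd h hL1⟩, ?_⟩
          have hx := bW_stem t 1 s L (l + R.A t)
          rw [add_comm 1 s, hI_one, hA_one, pow_one] at hx
          rw [hx]
          rcases e4 with e4 | ⟨e4, st, ls, e5, e6, e7⟩
          · left; nlinarith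
          · right
            exact ⟨by linear_combination e4, Or.inr ⟨st, ls, e5, by omega, e7⟩⟩
    obtain ⟨s₁, L₁, a1, a2, a3, a4⟩ := hbr
    by_cases hR : R = Fo.nil
    · subst hR
      refine ⟨s₁, L₁, by simp [Fo.leaves, a1], by simp [Fo.size, a2], a3, ?_⟩
      simp only [Fo.A, Fo.W, add_zero, mul_zero] at a4 ⊢
      rcases a4 with a4 | ⟨a4, a5⟩
      · left; linarith
      · right
        refine ⟨by linarith, ?_⟩
        rcases a5 with ⟨rfl, p, rfl, rfl⟩ | ⟨st, ls, rfl, h6, h7⟩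
        · exact ⟨[], [a :: p], rfl, rfl, by simp⟩
        · exact ⟨a :: st, ls, rfl, by simp [h6], h7⟩
    · obtain ⟨s₂, L₂, b1, b2, b3, b4⟩ := ihR (l + bA t s₁ L₁) hR
      obtain ⟨s, L, c1, c2, c3, c4⟩ := comb ht ht1 a3 b3 l
      refine ⟨s, L, by simp [Fo.leaves]; omega, by simp [Fo.size]; omega, c3, ?_⟩
      simp only [Fo.A, Fo.W]
      rcases a4 with a4 | ⟨a4, a5⟩
      · left
        have b4' := b4.elim le_of_lt (fun h => h.1.le)
        have c4' := c4.elim (fun h => h.2.2.2.2.le) le_of_lt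
        nlinarith
      rcases b4 with b4 | ⟨b4, b5⟩
      · left
        have c4' := c4.elim (fun h => h.2.2.2.2.le) le_of_lt
        nlinarith
      rcases c4 with ⟨rfl, rfl, rfl, rfl, c4⟩ | c4
      · right
        refine ⟨by linear_combination a4 + b4 + c4, ?_⟩
        obtain ⟨st, ls, rfl, h6, h7⟩ := b5
        have : st = [] := List.length_eq_zero_iff.1 h6
        subst this
        rcases a5 with ⟨_, p, rfl, rfl⟩ | ⟨st, ls, _, h6, _⟩
        · exact ⟨[], (a :: p) :: ls, rfl, rfl, by simp [h7]⟩
        · omega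
      · left; nlinarith

/-! ### Dominator tree -/

section Dominators

variable {V : Type*}

def delV (G : SimpleGraph V) (v : V) : SimpleGraph V where
  Adj x y := G.Adj x y ∧ x ≠ v ∧ y ≠ v
  symm := ⟨fun _ _ h => ⟨h.1.symm, h.2.2, h.2.1⟩⟩
  loopless := ⟨fun _ h => h.1.ne rfl⟩

def CutS (G : SimpleGraph V) (v : V) : Prop :=
  ∃ a b, a ≠ v ∧ b ≠ v ∧ G.Reachable a b ∧ ¬ (delV G v).Reachable a b

lemma reach_ind {G : SimpleGraph V} {a b : V} (h : G.Reachable a b) (P : V → Prop) (ha : P a)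
    (hs : ∀ x y, G.Adj x y → P x → P y) : P b := by
  obtain ⟨w⟩ := h
  induction w with
  | nil => exact ha
  | cons h p ih => exact ih (hs _ _ h ha)

lemma reach_step {G : SimpleGraph V} {a b c : V} (h : G.Reachable a b) (hbc : G.Adj b c) :
    G.Reachable a c := h.trans hbc.reachable

lemma cutS_of_isCut [Fintype V] {G : SimpleGraph V} {v : V} (h : IsCutVertex G v) :
    CutS G v := by
  classical
  by_contra hn
  unfold CutS at hn
  push Not at hn
  refine absurd h (not_lt.2 ?_)
  refine Nat.card_le_card_of_injective
    (ConnectedComponent.map (Embedding.induce ({v}ᶜ : Set V)).toHom) ?_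
  intro c d
  induction c using ConnectedComponent.ind with | _ a =>
  induction d using ConnectedComponent.ind with | _ b =>
  intro hcd
  simp only [ConnectedComponent.map_mk, ConnectedComponent.eq] at hcd
  have := hn a b a.2 b.2 hcd
  rw [ConnectedComponent.eq]
  have h2 := reach_ind this (fun y => ∀ hy : y ∈ ({v}ᶜ : Set V),
      (G.induce ({v}ᶜ : Set V)).Reachable a ⟨y, hy⟩) (fun _ => Reachable.refl _) (by
    intro x y hxy hx hy
    exact reach_step (hx hxy.2.1) hxy.1)
  exact h2 b.2

lemma exists_not_cutS [Fintype V] [Nontrivial V] {G : SimpleGraph V} (hc : G.Connected) :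
    ∃ r, ¬ CutS G r := by
  obtain ⟨r, hr⟩ := hc.exists_connected_induce_compl_singleton_of_finite_nontrivial
  refine ⟨r, ?_⟩
  rintro ⟨a, b, ha, hb, _, h⟩
  apply h
  have := hr.preconnected ⟨a, ha⟩ ⟨b, hb⟩
  exact this.map (G' := delV G r) ⟨fun x => x.1, fun {x y} hxy => ⟨hxy, x.2, y.2⟩⟩

lemma exists_connect (G : SimpleGraph V) [Nonempty V] :
    ∃ G' : SimpleGraph V, G ≤ G' ∧ G'.Connected ∧ ∀ v, CutS G v → CutS G' v := by
  let rep : V → V := fun x => (G.connectedComponentMk x).out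
  have hrep : ∀ x, G.Reachable (rep x) x := by
    intro x
    have : G.connectedComponentMk (rep x) = G.connectedComponentMk x := Quot.out_eq _
    exact ConnectedComponent.eq.1 this
  have hrep2 : ∀ x y, G.Reachable x y → rep x = rep y := by
    intro x y h
    simp only [rep]
    rw [ConnectedComponent.eq.2 h]
  let G' : SimpleGraph V :=
    { Adj := fun x y => G.Adj x y ∨ (x ≠ y ∧ rep x = x ∧ rep y = y)
      symm := ⟨by
        rintro x y (h | h)
        · exact Or.inl h.symm
        · exact Or.inr ⟨h.1.symm, h.2.2, h.2.1⟩⟩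
      loopless := ⟨by
        rintro x (h | h)
        · exact h.ne rfl
        · exact h.1 rfl⟩ }
  have hle : G ≤ G' := fun x y h => Or.inl h
  refine ⟨G', hle, ?_, ?_⟩
  · rw [connected_iff]
    refine ⟨?_, inferInstance⟩
    intro x y
    have h1 := (hrep x).mono hle
    have h2 := (hrep y).mono hle
    refine h1.symm.trans (Reachable.trans ?_ h2)
    by_cases h : rep x = rep y
    · rw [h]
    · exact Adj.reachable (Or.inr ⟨h, hrep2 _ _ (hrep x), hrep2 _ _ (hrep y)⟩)
  · rintro v ⟨a, b, ha, hb, hab, hn⟩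
    refine ⟨a, b, ha, hb, hab.mono hle, ?_⟩
    intro hr
    apply hn
    have := reach_ind hr (fun w => (G.Reachable a w ∧ (delV G v).Reachable a w) ∨
      (¬ G.Reachable a w ∧ (delV G v).Reachable a (rep a))) (Or.inl ⟨.refl _, .refl _⟩) (by
        rintro x y ⟨hxy | hxy, hxv, hyv⟩ hx
        · rcases hx with hx | hx
          · exact Or.inl ⟨reach_step hx.1 hxy, reach_step hx.2 ⟨hxy, hxv, hyv⟩⟩
          · exact Or.inr ⟨fun h => hx.1 (reach_step h hxy.symm), hx.2⟩
        · have hdiff : ¬ G.Reachable x y := fun h => hxy.1 (by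
            rw [← hxy.2.1, ← hxy.2.2]; exact hrep2 _ _ h)
          rcases hx with hx | hx
          · right
            refine ⟨fun h => hdiff (hx.1.symm.trans h), ?_⟩
            rw [hrep2 _ _ hx.1, hxy.2.1]; exact hx.2
          · by_cases h : G.Reachable a y
            · left
              refine ⟨h, ?_⟩
              rw [← hxy.2.2, ← hrep2 _ _ h]; exact hx.2
            · exact Or.inr ⟨h, hx.2⟩)
    rcases this with h | h
    · exact h.2
    · exact absurd hab h.1

def Dm (G : SimpleGraph V) (r v : V) : Set V := {a | a ≠ v ∧ ¬ (delV G a).Reachable r v}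

lemma Dm_edge {G : SimpleGraph V} {r u v a : V} (h : G.Adj u v) (ha : a ∈ Dm G r v)
    (hau : a ≠ u) : a ∈ Dm G r u := by
  refine ⟨hau, fun h2 => ha.2 (reach_step h2 ⟨h, hau.symm, ha.1.symm⟩)⟩

lemma Dm_root {G : SimpleGraph V} {r a : V} : a ∉ Dm G r r := fun h => h.2 (.refl _)

lemma root_mem_Dm {G : SimpleGraph V} {r v : V} (h : v ≠ r) : r ∈ Dm G r v := by
  refine ⟨h.symm, fun h2 => ?_⟩
  have := reach_ind h2 (fun x => x = r) rfl (fun x y hxy hx => absurd hx hxy.2.1)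
  exact h this

lemma Dm_asymm {G : SimpleGraph V} (hc : G.Connected) {r a b : V} (h1 : a ∈ Dm G r b)
    (h2 : b ∈ Dm G r a) : False := by
  have hra : r ≠ a := by rintro rfl; exact Dm_root h2
  have hrb : r ≠ b := by rintro rfl; exact Dm_root h1
  have := reach_ind (hc.preconnected r a)
    (fun x => x ≠ a ∧ x ≠ b ∧ (delV G a).Reachable r x ∧ (delV G b).Reachable r x)
    ⟨hra, hrb, .refl _, .refl _⟩ (by
      rintro x y hxy ⟨hxa, hxb, hx1, hx2⟩
      have hya : y ≠ a := by
        rintro rfl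
        exact h2.2 (reach_step hx2 ⟨hxy, hxb, h1.1⟩)
      have hyb : y ≠ b := by
        rintro rfl
        exact h1.2 (reach_step hx1 ⟨hxy, hxa, h2.1⟩)
      exact ⟨hya, hyb, reach_step hx1 ⟨hxy, hxa, hya⟩, reach_step hx2 ⟨hxy, hxb, hyb⟩⟩)
  exact this.1 rfl

lemma Dm_trans {G : SimpleGraph V} (hc : G.Connected) {r a b v : V} (h1 : a ∈ Dm G r b)
    (h2 : b ∈ Dm G r v) : a ∈ Dm G r v := by
  refine ⟨?_, ?_⟩
  · rintro rfl; exact Dm_asymm hc h1 h2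
  · intro h
    apply h2.2
    have := reach_ind h (fun x => (delV G a).Reachable r x ∧ (delV G b).Reachable r x)
      ⟨.refl _, .refl _⟩ (by
        rintro x y hxy ⟨hx1, hx2⟩
        have hy := reach_step hx1 hxy
        exact ⟨hy, reach_step hx2 ⟨hxy.1, by rintro rfl; exact h1.2 hx1,
          by rintro rfl; exact h1.2 hy⟩⟩)
    exact this.2

lemma Dm_total {G : SimpleGraph V} (hc : G.Connected) {r a b v : V} (h1 : a ∈ Dm G r v)
    (h2 : b ∈ Dm G r v) (hab : a ≠ b) : a ∈ Dm G r b ∨ b ∈ Dm G r a := by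
  by_contra hn
  push Not at hn
  have hb : (delV G a).Reachable r b := by
    by_contra h; exact hn.1 ⟨hab, h⟩
  have ha : (delV G b).Reachable r a := by
    by_contra h; exact hn.2 ⟨hab.symm, h⟩
  have := reach_ind (hc.preconnected v a)
    (fun x => x ≠ a ∧ x ≠ b ∧ (delV G a).Reachable v x ∧ (delV G b).Reachable v x)
    ⟨h1.1.symm, h2.1.symm, .refl _, .refl _⟩ (by
      rintro x y hxy ⟨hxa, hxb, hx1, hx2⟩
      have hya : y ≠ a := by
        rintro rfl
        exact h2.2 (ha.trans (reach_step hx2 ⟨hxy, hxb, hab⟩).symm)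
      have hyb : y ≠ b := by
        rintro rfl
        exact h1.2 (hb.trans (reach_step hx1 ⟨hxy, hxa, hab.symm⟩).symm)
      exact ⟨hya, hyb, reach_step hx1 ⟨hxy, hxa, hya⟩, reach_step hx2 ⟨hxy, hxb, hyb⟩⟩)
  exact this.1 rfl

lemma Dm_parent [Finite V] {G : SimpleGraph V} (hc : G.Connected) {r v : V} (hv : v ≠ r) :
    ∃ b, b ∈ Dm G r v ∧ Dm G r v = insert b (Dm G r b) := by
  obtain ⟨b, hb, hmax⟩ := Set.exists_max_image (Dm G r v) (fun b => (Dm G r b).ncard)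
    (Set.toFinite _) ⟨r, root_mem_Dm hv⟩
  refine ⟨b, hb, Set.Subset.antisymm ?_ ?_⟩
  · intro a ha
    by_cases hab : a = b
    · exact Or.inl hab
    rcases Dm_total hc ha hb hab with h | h
    · exact Or.inr h
    · exfalso
      have h1 : insert b (Dm G r b) ⊆ Dm G r a := by
        rintro x (rfl | hx)
        · exact h
        · exact Dm_trans hc hx h
      have h2 := Set.ncard_le_ncard h1 (Set.toFinite _)
      rw [Set.ncard_insert_of_notMem (fun h => h.1 rfl) (Set.toFinite _)] at h2
      have := hmax a ha
      omega
  · rintro x (rfl | hx)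
    · exact hb
    · exact Dm_trans hc hx hb

lemma Dm_parent_unique {G : SimpleGraph V} (hc : G.Connected) {r b c : V}
    (h : insert b (Dm G r b) = insert c (Dm G r c)) : b = c := by
  by_contra hbc
  have h1 : b ∈ insert c (Dm G r c) := h ▸ Set.mem_insert _ _
  have h2 : c ∈ insert b (Dm G r b) := h ▸ Set.mem_insert _ _
  exact Dm_asymm hc (h1.resolve_left hbc) (h2.resolve_left (Ne.symm hbc))

structure DTree (G : SimpleGraph V) (r : V) (par : V → V) (dep : V → ℕ) : Prop where
  dep_r : dep r = 0
  dep_par : ∀ v, v ≠ r → dep v = dep (par v) + 1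
  edge : ∀ u v, G.Adj u v →
    (v ≠ r ∧ par v = u) ∨ (u ≠ r ∧ par u = v) ∨ (u ≠ r ∧ v ≠ r ∧ par u = par v)
  cut : ∀ v, v ≠ r → CutS G v → ∃ w, w ≠ r ∧ par w = v
  dep_lt : ∀ v, dep v < Nat.card V

lemma exists_DTree [Finite V] {G : SimpleGraph V} (hc : G.Connected) (r : V) :
    ∃ par dep, DTree G r par dep := by
  classical
  have hp : ∀ v, ∃ b, v ≠ r → b ∈ Dm G r v ∧ Dm G r v = insert b (Dm G r b) := by
    intro v
    by_cases hv : v = r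
    · exact ⟨v, fun h => absurd hv h⟩
    · obtain ⟨b, hb⟩ := Dm_parent hc hv
      exact ⟨b, fun _ => hb⟩
  choose par hpar using hp
  have hdp : ∀ v, v ≠ r → (Dm G r v).ncard = (Dm G r (par v)).ncard + 1 := by
    intro v hv
    rw [(hpar v hv).2, Set.ncard_insert_of_notMem (fun h => h.1 rfl) (Set.toFinite _)]
  refine ⟨par, fun v => (Dm G r v).ncard, ?_, hdp, ?_, ?_, ?_⟩
  · rw [Set.ncard_eq_zero (Set.toFinite _), Set.eq_empty_iff_forall_notMem]
    exact fun a => Dm_root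
  · have key : ∀ u v, G.Adj u v → u ∈ Dm G r v → v ≠ r ∧ par v = u := by
      intro u v h hu
      have hv : v ≠ r := by rintro rfl; exact Dm_root hu
      refine ⟨hv, ?_⟩
      apply Dm_parent_unique hc (r := r)
      rw [← (hpar v hv).2]
      apply Set.Subset.antisymm
      · intro a ha
        by_cases hau : a = u
        · exact Or.inl hau
        · exact Or.inr (Dm_edge h ha hau)
      · rintro x (rfl | hx)
        · exact hu
        · exact Dm_trans hc hx hu
    intro u v h
    by_cases h1 : u ∈ Dm G r v
    · exact Or.inl (key u v h h1)
    by_cases h2 : v ∈ Dm G r u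
    · exact Or.inr (Or.inl (key v u h.symm h2))
    have hu : u ≠ r := by
      rintro rfl; exact h1 (root_mem_Dm h.ne')
    have hv : v ≠ r := by
      rintro rfl; exact h2 (root_mem_Dm h.ne)
    refine Or.inr (Or.inr ⟨hu, hv, ?_⟩)
    apply Dm_parent_unique hc (r := r)
    rw [← (hpar v hv).2, ← (hpar u hu).2]
    apply Set.Subset.antisymm
    · intro a ha
      exact Dm_edge h.symm ha (by rintro rfl; exact h2 ha)
    · intro a ha
      exact Dm_edge h ha (by rintro rfl; exact h1 ha)
  · rintro v hv ⟨a, b, ha, hb, _, hn⟩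
    have hw : ∃ w, v ∈ Dm G r w := by
      by_contra h
      push Not at h
      have h1 : (delV G v).Reachable r a := by
        by_contra h'; exact h a ⟨ha.symm, h'⟩
      have h2 : (delV G v).Reachable r b := by
        by_contra h'; exact h b ⟨hb.symm, h'⟩
      exact hn (h1.symm.trans h2)
    obtain ⟨w, hw, hmin⟩ := Set.exists_min_image {w | v ∈ Dm G r w}
      (fun w => (Dm G r w).ncard) (Set.toFinite _) hw
    have hwr : w ≠ r := by rintro rfl; exact Dm_root hw
    refine ⟨w, hwr, ?_⟩
    by_contra hne
    have h1 : v ∈ insert (par w) (Dm G r (par w)) := (hpar w hwr).2 ▸ hw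
    have h2 := hmin (par w) (h1.resolve_left (Ne.symm hne))
    have h3 := hdp w hwr
    omega
  · intro v
    have : Dm G r v ⊂ Set.univ := by
      rw [Set.ssubset_univ_iff]
      intro h
      have : v ∈ Dm G r v := h ▸ Set.mem_univ v
      exact this.1 rfl
    have := Set.ncard_lt_ncard this (Set.toFinite _)
    rwa [Set.ncard_univ] at this

end Dominators

/-! ### Pair sums and the forest of a graph -/

section Forest

variable {V : Type*}

noncomputable def gf (G : SimpleGraph V) (t : ℝ) (u v : V) : ℝ :=
  if G.dist u v = 0 then 0 else t ^ (G.dist u v)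

def ps (f : V → V → ℝ) : List V → ℝ
  | [] => 0
  | a :: l => (l.map (f a)).sum + ps f l

def crs (f : V → V → ℝ) (l m : List V) : ℝ := (l.map (fun x => (m.map (f x)).sum)).sum

lemma ps_append (f : V → V → ℝ) (l m : List V) : ps f (l ++ m) = ps f l + ps f m + crs f l m := by
  induction l with
  | nil => simp [ps, crs]
  | cons a l ih =>
    simp only [List.cons_append, ps, ih, List.map_append, List.sum_append, crs, List.map_cons,
      List.sum_cons]
    ring

lemma gf_le {G : SimpleGraph V} {t : ℝ} (ht : 0 < t) (ht1 : t < 1) {u v : V} {m : ℕ}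
    (h : m ≤ G.dist u v) : gf G t u v ≤ t ^ m := by
  unfold gf
  split_ifs
  · positivity
  · exact pow_le_pow_of_le_one ht.le ht1.le h

lemma gf_lt {G : SimpleGraph V} {t : ℝ} (ht : 0 < t) (ht1 : t < 1) {u v : V}
    (h : ¬ G.Adj u v) : gf G t u v < t := by
  unfold gf
  split_ifs with h0
  · exact ht
  · have h1 : G.dist u v ≠ 1 := fun h1 => h (dist_eq_one_iff_adj.1 h1)
    calc t ^ G.dist u v ≤ t ^ 2 := pow_le_pow_of_le_one ht.le ht1.le (by omega)
      _ < t := by nlinarith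

lemma lip_dist {G : SimpleGraph V} (hc : G.Connected) (f : V → ℤ)
    (hf : ∀ u v, G.Adj u v → f u ≤ f v + 1) (u v : V) : f u - f v ≤ G.dist u v := by
  obtain ⟨w, hw⟩ := hc.exists_walk_length_eq_dist u v
  rw [← hw]
  clear hw
  induction w with
  | nil => simp
  | cons h p ih =>
    have := hf _ _ h
    simp only [Walk.length_cons]
    push_cast
    linarith

def Anc (par : V → V) (dep : V → ℕ) (c x : V) : Prop :=
  dep c ≤ dep x ∧ par^[dep x - dep c] x = c

variable {G : SimpleGraph V} {r : V} {par : V → V} {dep : V → ℕ}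

lemma anc_self (c : V) : Anc par dep c c := ⟨le_rfl, by simp⟩

lemma anc_unique {c d x : V} (h1 : Anc par dep c x) (h2 : Anc par dep d x)
    (h : dep c = dep d) : c = d := by
  rw [← h1.2, ← h2.2, h]

namespace DTree


lemma dep_zero (D : DTree G r par dep) {x : V} (h : dep x = 0) : x = r := by
  by_contra hx
  have := D.dep_par x hx
  omega

lemma anc_par (D : DTree G r par dep) {c x : V} (hx : x ≠ r) (h : Anc par dep c (par x)) : Anc par dep c x := by
  have h1 := D.dep_par x hx
  have h2 := h.1
  refine ⟨by omega, ?_⟩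
  rw [show dep x - dep c = (dep (par x) - dep c) + 1 by omega, Function.iterate_succ_apply]
  exact h.2

lemma anc_of_ne (D : DTree G r par dep) {c x : V} (h : Anc par dep c x) (hne : x ≠ c) :
    x ≠ r ∧ Anc par dep c (par x) := by
  obtain ⟨h1, h2⟩ := h
  have h3 : dep x - dep c ≠ 0 := by
    intro h0
    rw [h0] at h2
    exact hne h2
  have hx : x ≠ r := by
    rintro rfl
    have := D.dep_r
    omega
  have h4 := D.dep_par x hx
  refine ⟨hx, by omega, ?_⟩
  rw [show dep x - dep c = (dep (par x) - dep c) + 1 by omega, Function.iterate_succ_apply] at h2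
  exact h2

lemma dep_iter (D : DTree G r par dep) (m : ℕ) : ∀ x, m ≤ dep x → dep (par^[m] x) = dep x - m := by
  induction m with
  | zero => simp
  | succ m ih =>
    intro x hx
    have hxr : x ≠ r := by
      rintro rfl
      have := D.dep_r
      omega
    have := D.dep_par x hxr
    rw [Function.iterate_succ_apply, ih _ (by omega)]
    omega

lemma anc_trans (D : DTree G r par dep) {c d x : V} (hd : d ≠ r) (hp : par d = c) (h : Anc par dep d x) :
    Anc par dep c x := by
  have h1 := D.dep_par d hd
  rw [hp] at h1
  have h2 := h.1
  refine ⟨by omega, ?_⟩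
  rw [show dep x - dep c = (dep x - dep d) + 1 by omega, Function.iterate_succ_apply', h.2, hp]

lemma anc_child (D : DTree G r par dep) {c x : V} (h : Anc par dep c x) (hne : x ≠ c) :
    ∃ d, d ≠ r ∧ par d = c ∧ Anc par dep d x := by
  obtain ⟨h1, h2⟩ := h
  have h3 : dep x - dep c ≠ 0 := by
    intro h0
    rw [h0] at h2
    exact hne h2
  have h4 := D.dep_iter (dep x - dep c - 1) x (by omega)
  refine ⟨par^[dep x - dep c - 1] x, ?_, ?_, ?_, ?_⟩
  · intro h
    rw [h, D.dep_r] at h4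
    omega
  · rw [← Function.iterate_succ_apply' par, show (dep x - dep c - 1).succ = dep x - dep c by omega]
    exact h2
  · omega
  · rw [h4, show dep x - (dep x - (dep x - dep c - 1)) = dep x - dep c - 1 by omega]

lemma dist_anc (D : DTree G r par dep) (hc : G.Connected) (a x : V) : dep x - dep a ≤ G.dist a x := by
  have := lip_dist hc (fun v => (dep v : ℤ)) (by
    intro u v h
    rcases D.edge u v h with h | h | h
    · have := D.dep_par v h.1
      rw [h.2] at this; omega
    · have := D.dep_par u h.1
      rw [h.2] at this; omega
    · have h1 := D.dep_par u h.1
      have h2 := D.dep_par v h.2.1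
      rw [h.2.2] at h1; omega) x a
  rw [dist_comm]
  omega

lemma dist_sib (D : DTree G r par dep) (hc : G.Connected) {a b x y : V} (ha : a ≠ r) (hb : b ≠ r) (hp : par a = par b)
    (hab : a ≠ b) (hx : Anc par dep a x) (hy : Anc par dep b y) :
    (dep x - dep a) + (dep y - dep b) + 1 ≤ G.dist x y := by
  classical
  have hda := D.dep_par a ha
  have hdb := D.dep_par b hb
  rw [← hp] at hdb
  let f : V → ℤ := fun w => if Anc par dep a w then (dep w : ℤ) - dep a + 1
    else if Anc par dep b w then -((dep w : ℤ) - dep b) else 0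
  -- parent-child edges
  have hpc : ∀ u v, v ≠ r → par v = u → f u ≤ f v + 1 ∧ f v ≤ f u + 1 := by
    intro u v hv hu
    have hdv := D.dep_par v hv
    rw [hu] at hdv
    have key : ∀ c, Anc par dep c v ↔ (v = c ∨ Anc par dep c u) := by
      intro c
      constructor
      · intro h
        by_cases hvc : v = c
        · exact Or.inl hvc
        · exact Or.inr (hu ▸ (D.anc_of_ne h hvc).2)
      · rintro (rfl | h)
        · exact anc_self _
        · exact D.anc_par hv (hu.symm ▸ h)
    have na : v = a → ¬ Anc par dep a u ∧ ¬ Anc par dep b u := by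
      rintro rfl
      constructor <;> intro h <;> have := h.1 <;> omega
    have nb : v = b → ¬ Anc par dep a u ∧ ¬ Anc par dep b u := by
      rintro rfl
      constructor <;> intro h <;> have := h.1 <;> omega
    simp only [f, key]
    by_cases h1 : v = a
    · subst h1
      simp [na rfl]
    · by_cases h2 : v = b
      · subst h2
        simp [nb rfl, h1]
      · simp only [h1, h2, false_or]
        split_ifs <;> constructor <;> omega
  have hsib : ∀ u v, u ≠ v → u ≠ r → v ≠ r → par u = par v → f u ≤ f v + 1 := by
    intro u v huv hu hv hp'
    have hdu := D.dep_par u hu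
    have hdv := D.dep_par v hv
    rw [← hp'] at hdv
    have key : ∀ c w, w ≠ r → par w = par u → (Anc par dep c w ↔ (w = c ∨ Anc par dep c (par u))) := by
      intro c w hw hwu
      constructor
      · intro h
        by_cases hvc : w = c
        · exact Or.inl hvc
        · exact Or.inr (hwu ▸ (D.anc_of_ne h hvc).2)
      · rintro (rfl | h)
        · exact anc_self _
        · exact D.anc_par hw (hwu.symm ▸ h)
    have f1 := fun c => key c u hu rfl
    have f2 := fun c => key c v hv hp'.symm
    have hle : ∀ c, dep (par u) < dep c → ¬ Anc par dep c (par u) := by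
      intro c h h'
      have := h'.1
      omega
    simp only [f, f1, f2]
    by_cases g1 : Anc par dep a (par u)
    · simp only [g1, or_true, if_true]; omega
    by_cases g2 : Anc par dep b (par u)
    · have : dep b ≤ dep (par u) := g2.1
      have n1 : u ≠ a := by rintro rfl; omega
      have n2 : v ≠ a := by rintro rfl; omega
      simp only [g1, g2, n1, n2, or_true, or_false, if_true, if_false]; omega
    simp only [g1, g2, or_false]
    by_cases n1 : u = a
    · subst n1
      simp only [Ne.symm huv, if_true, if_false]
      split_ifs with n4
      · subst n4; omega
      · omega
    · simp only [n1, if_false]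
      split_ifs <;> first | omega | (subst_vars; omega)
  have hf : ∀ u v, G.Adj u v → f u ≤ f v + 1 := by
    intro u v h
    rcases D.edge u v h with h' | h' | h'
    · exact (hpc u v h'.1 h'.2).1
    · exact (hpc v u h'.1 h'.2).2
    · exact hsib u v h.ne h'.1 h'.2.1 h'.2.2
  have hl := lip_dist hc f hf x y
  have hya : ¬ Anc par dep a y := fun h => hab (anc_unique h hy (by omega))
  simp only [f, hx, hya, hy, if_true, if_false] at hl
  have := hx.1
  have := hy.1
  omega

end DTree

def fo (ch : V → List V) : ℕ → List V → Fo V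
  | 0, _ => Fo.nil
  | f + 1, l => l.foldr (fun c T => Fo.node c (fo ch f (ch c)) T) Fo.nil

def FCompl (G : SimpleGraph V) : Fo V → Prop
  | Fo.nil => True
  | Fo.node a C R => (∀ c ∈ C.roots, G.Adj a c) ∧ (∀ b ∈ R.roots, G.Adj a b) ∧
      FCompl G C ∧ FCompl G R

lemma size_eq (T : Fo V) : T.size = T.labels.length := by
  induction T with
  | nil => rfl
  | node a C R h1 h2 => simp [Fo.size, Fo.labels, h1, h2]; ring

lemma sum_le_or (l m : List V) (f g : V → ℝ) (P : V → Prop) (hm : ∀ x ∈ m, x ∈ l)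
    (h : ∀ x ∈ l, f x ≤ g x) (hs : ∀ x ∈ m, ¬ P x → f x < g x) :
    (l.map f).sum < (l.map g).sum ∨ ((l.map f).sum ≤ (l.map g).sum ∧ ∀ x ∈ m, P x) := by
  by_cases hP : ∀ x ∈ m, P x
  · exact Or.inr ⟨List.sum_le_sum h, hP⟩
  · push Not at hP
    obtain ⟨x, hx, hx'⟩ := hP
    exact Or.inl (List.sum_lt_sum _ _ h ⟨x, hm x hx, hs x hx hx'⟩)

structure FoOK (G : SimpleGraph V) (par : V → V) (dep : V → ℕ) (ch : V → List V) (t : ℝ)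
    (p : V) (l : List V) (T : Fo V) : Prop where
  mem : ∀ x, x ∈ T.labels ↔ ∃ c ∈ l, Anc par dep c x
  nodup : T.labels.Nodup
  hA : T.A t = (T.labels.map (fun x => t ^ (dep x - (dep p + 1)))).sum
  hps : ps (gf G t) T.labels < T.W t ∨ (ps (gf G t) T.labels ≤ T.W t ∧ FCompl G T)
  hleaves : T.leaves = T.labels.countP (fun x => (ch x).isEmpty)
  hroots : T.roots = l

lemma fo_ok [Finite V] (hc : G.Connected) (D : DTree G r par dep) (ch : V → List V)
    (hch : ∀ x v, v ∈ ch x ↔ v ≠ r ∧ par v = x) (hchn : ∀ x, (ch x).Nodup)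
    {t : ℝ} (ht : 0 < t) (ht1 : t < 1) :
    ∀ (f : ℕ) (p : V), Nat.card V ≤ f + dep p + 1 → ∀ l : List V, l.Nodup →
      (∀ c ∈ l, c ≠ r ∧ par c = p) → FoOK G par dep ch t p l (fo ch f l) := by
  have hnil : ∀ p, FoOK G par dep ch t p [] (Fo.nil : Fo V) := fun p =>
    ⟨by simp [Fo.labels], by simp [Fo.labels], by simp [Fo.labels, Fo.A],
      Or.inr ⟨by simp [Fo.labels, ps, Fo.W], trivial⟩, by simp [Fo.labels, Fo.leaves], rfl⟩
  intro f
  induction f with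
  | zero =>
    intro p hp l hn hl
    have : l = [] := by
      rw [List.eq_nil_iff_forall_not_mem]
      intro c hcl
      have h1 := D.dep_par c (hl c hcl).1
      rw [(hl c hcl).2] at h1
      have := D.dep_lt c
      omega
    subst this
    exact hnil p
  | succ f ihf =>
    intro p hp l
    induction l with
    | nil => intro _ _; exact hnil p
    | cons c l ihl =>
      intro hn hl
      have hR := ihl (List.nodup_cons.1 hn).2 (fun x hx => hl x (by simp [hx]))
      have hcr := (hl c (by simp)).1
      have hcp := (hl c (by simp)).2
      have hdc := D.dep_par c hcr
      rw [hcp] at hdc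
      have hC := ihf c (by omega) (ch c) (hchn c) (fun x hx => (hch c x).1 hx)
      have hun : fo ch (f + 1) (c :: l) = Fo.node c (fo ch f (ch c)) (fo ch (f + 1) l) := rfl
      rw [hun]
      set C := fo ch f (ch c)
      set R := fo ch (f + 1) l
      have hdepC : ∀ x ∈ C.labels, dep c + 1 ≤ dep x := by
        intro x hx
        obtain ⟨d, hd, hdx⟩ := (hC.mem x).1 hx
        have h1 := (hch c d).1 hd
        have h2 := D.dep_par d h1.1
        rw [h1.2] at h2
        have := hdx.1
        omega
      have hancC : ∀ x ∈ C.labels, Anc par dep c x := by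
        intro x hx
        obtain ⟨d, hd, hdx⟩ := (hC.mem x).1 hx
        have h1 := (hch c d).1 hd
        exact D.anc_trans h1.1 h1.2 hdx
      have hancR : ∀ y ∈ R.labels, ∃ b, b ≠ r ∧ par b = p ∧ b ≠ c ∧ dep b = dep c ∧
          Anc par dep b y := by
        intro y hy
        obtain ⟨b, hb, hby⟩ := (hR.mem y).1 hy
        obtain ⟨h1, h2⟩ := hl b (by simp [hb])
        have h3 := D.dep_par b h1
        rw [h2] at h3
        refine ⟨b, h1, h2, ?_, by omega, hby⟩
        rintro rfl
        exact (List.nodup_cons.1 hn).1 hb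
      have hdepR : ∀ y ∈ R.labels, dep c ≤ dep y := by
        intro y hy
        obtain ⟨b, _, _, _, h, h'⟩ := hancR y hy
        have := h'.1
        omega
      have hdist : ∀ x y, Anc par dep c x → y ∈ R.labels →
          (dep x - dep c) + (dep y - dep c) + 1 ≤ G.dist x y := by
        intro x y hx hy
        obtain ⟨b, h1, h2, h3, h4, h5⟩ := hancR y hy
        have := D.dist_sib hc hcr h1 (hcp.trans h2.symm) h3.symm hx h5
        rwa [h4] at this
      have hrootsC : ∀ x ∈ C.roots, x ∈ C.labels ∧ dep x = dep c + 1 := by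
        intro x hx
        rw [hC.hroots] at hx
        refine ⟨(hC.mem x).2 ⟨x, hx, anc_self x⟩, ?_⟩
        have h1 := (hch c x).1 hx
        have h2 := D.dep_par x h1.1
        rwa [h1.2] at h2
      have hrootsR : ∀ x ∈ R.roots, x ∈ R.labels ∧ dep x = dep c := by
        intro x hx
        rw [hR.hroots] at hx
        refine ⟨(hR.mem x).2 ⟨x, hx, anc_self x⟩, ?_⟩
        obtain ⟨h1, h2⟩ := hl x (by simp [hx])
        have h3 := D.dep_par x h1
        rw [h2] at h3
        omega
      have hsC : (C.labels.map (fun x => t ^ (dep x - dep c))).sum = t * C.A t := by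
        rw [hC.hA, ← List.sum_map_mul_left]
        congr 1
        apply List.map_congr_left
        intro x hx
        have := hdepC x hx
        rw [← pow_succ']
        congr 1
        omega
      have hsR : (R.labels.map (fun x => t ^ (dep x - dep c))).sum = R.A t := by
        rw [hR.hA, hdc]
      refine ⟨?_, ?_, ?_, ?_, ?_, ?_⟩
      · intro x
        simp only [Fo.labels, List.mem_cons, List.mem_append, hC.mem, hR.mem, exists_eq_or_imp]
        rw [← or_assoc]
        apply or_congr_left
        constructor
        · rintro (rfl | ⟨d, hd, hdx⟩)
          · exact anc_self _
          · have h1 := (hch c d).1 hd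
            exact D.anc_trans h1.1 h1.2 hdx
        · intro h
          by_cases hx : x = c
          · exact Or.inl hx
          · obtain ⟨d, h1, h2, h3⟩ := D.anc_child h hx
            exact Or.inr ⟨d, (hch c d).2 ⟨h1, h2⟩, h3⟩
      · simp only [Fo.labels, List.nodup_cons, List.nodup_append, List.mem_append]
        refine ⟨?_, hC.nodup, hR.nodup, ?_⟩
        · rintro (h | h)
          · have := hdepC c h
            omega
          · obtain ⟨b, _, _, h3, h4, h5⟩ := hancR c h
            exact h3 (anc_unique h5 (anc_self c) h4)
        · rintro x hx y hy rfl
          obtain ⟨b, _, _, h3, h4, h5⟩ := hancR x hy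
          exact h3 (anc_unique h5 (hancC x hx) h4)
      · simp only [Fo.A, Fo.labels, List.map_cons, List.map_append, List.sum_cons,
          List.sum_append]
        rw [← hdc, hsC, hsR]
        simp; ring
      · have e1 := sum_le_or C.labels C.roots (gf G t c) (fun x => t ^ (dep x - dep c))
          (fun x => G.Adj c x) (fun x hx => (hrootsC x hx).1)
          (fun x _ => gf_le ht ht1 (D.dist_anc hc c x))
          (fun x hx h => by
            simp only [(hrootsC x hx).2]
            simpa using gf_lt ht ht1 h)
        have e2 := sum_le_or R.labels R.roots (gf G t c) (fun y => t * t ^ (dep y - dep c))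
          (fun x => G.Adj c x) (fun x hx => (hrootsR x hx).1)
          (fun x hx => by
            rw [← pow_succ']
            apply gf_le ht ht1
            have := hdist c x (anc_self c) hx
            omega)
          (fun x hx h => by
            simp only [(hrootsR x hx).2]
            simpa using gf_lt ht ht1 h)
        have e3 : crs (gf G t) C.labels R.labels ≤ t * (t * C.A t) * R.A t := by
          have : t * (t * C.A t) * R.A t = (C.labels.map (fun x => (R.labels.map
              (fun y => t ^ (dep x - dep c) * (t * t ^ (dep y - dep c)))).sum)).sum := by
            simp only [List.sum_map_mul_left, List.sum_map_mul_right, hsC, hsR]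
            ring
          rw [this]
          apply List.sum_le_sum
          intro x hx
          apply List.sum_le_sum
          intro y hy
          have := hdist x y (hancC x hx) hy
          rw [← pow_succ', ← pow_add]
          apply gf_le ht ht1
          omega
        rw [hsC] at e1
        rw [List.sum_map_mul_left, hsR] at e2
        simp only [Fo.labels, ps, List.map_append, List.sum_append, ps_append, Fo.W, FCompl]
        have e4 := hC.hps
        have e5 := hR.hps
        have m1 := e1.elim le_of_lt (fun h => h.1)
        have m2 := e2.elim le_of_lt (fun h => h.1)
        have m4 := e4.elim le_of_lt (fun h => h.1)
        have m5 := e5.elim le_of_lt (fun h => h.1)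
        rcases e1 with e1 | ⟨_, e1⟩
        · left; nlinarith
        rcases e2 with e2 | ⟨_, e2⟩
        · left; nlinarith
        rcases e4 with e4 | ⟨_, e4⟩
        · left; nlinarith
        rcases e5 with e5 | ⟨_, e5⟩
        · left; nlinarith
        right
        exact ⟨by nlinarith, e1, e2, e4, e5⟩
      · simp only [Fo.leaves, Fo.labels, List.countP_cons, List.countP_append, ← hC.hleaves,
          ← hR.hleaves]
        by_cases he : ch c = []
        · have : C = Fo.nil := by
            have := hC.hroots
            rw [he] at this
            cases hCC : C with
            | nil => rfl
            | node a X Y => rw [hCC] at this; simp [Fo.roots] at this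
          simp [this, he, Fo.leaves]; ring
        · have hC0 : C ≠ Fo.nil := by
            intro h
            have := hC.hroots
            rw [h] at this
            exact he this.symm
          have := Fo.leaves_pos hC0
          simp [he]; omega
      · simp only [Fo.roots, hR.hroots]

end Forest

/-! ### Leg structures -/

section Legs

variable {V : Type*}

def RD (G : SimpleGraph V) (u v : V) (m : ℕ) : Prop := G.Reachable u v ∧ G.dist u v ≤ m

lemma RD.step {G : SimpleGraph V} {u v w : V} {m : ℕ} (h : RD G u v m) (ha : G.Adj v w) :
    RD G u w (m + 1) := by
  obtain ⟨p, hp⟩ := h.1.exists_walk_length_eq_dist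
  refine ⟨h.1.trans ha.reachable, ?_⟩
  have := dist_le (p.append ha.toWalk)
  have h2 := h.2
  simp at this
  omega

lemma RD.symm {G : SimpleGraph V} {u v : V} {m : ℕ} (h : RD G u v m) : RD G v u m :=
  ⟨h.1.symm, by rw [dist_comm]; exact h.2⟩

lemma RD.adj {G : SimpleGraph V} {u v : V} (h : G.Adj u v) : RD G u v 1 :=
  ⟨h.reachable, by rw [dist_eq_one_iff_adj.2 h]⟩

lemma RD.le_gf {G : SimpleGraph V} {t : ℝ} (ht : 0 < t) (ht1 : t < 1) {u v : V} {m : ℕ}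
    (h : RD G u v m) (hne : u ≠ v) : t ^ m ≤ gf G t u v := by
  unfold gf
  have := h.1.pos_dist_of_ne hne
  rw [if_neg (by omega)]
  exact pow_le_pow_of_le_one ht.le ht1.le h.2

lemma gf_nonneg (G : SimpleGraph V) {t : ℝ} (ht : 0 < t) (u v : V) : 0 ≤ gf G t u v := by
  unfold gf
  split_ifs
  · exact le_rfl
  · positivity

lemma chain_from {G : SimpleGraph V} {t : ℝ} (ht : 0 < t) (ht1 : t < 1) (u : V) (l : List V) :
    ∀ m, (∀ a ∈ l.head?, RD G u a m) → l.IsChain G.Adj → u ∉ l →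
      t ^ m * hA t l.length ≤ (l.map (gf G t u)).sum := by
  induction l with
  | nil => intros; simp [hA]
  | cons a l ih =>
    intro m h hc hu
    have h0 := h a (by simp)
    have h1 := h0.le_gf ht ht1 (fun e => hu (by simp [e]))
    have hc' := List.isChain_cons.1 hc
    have h2 := ih (m + 1) (fun b hb => h0.step (hc'.1 b hb)) hc'.2 (fun e => hu (by simp [e]))
    simp only [List.length_cons, hA, List.map_cons, List.sum_cons]
    rw [pow_succ] at h2
    linarith

lemma chain_cross {G : SimpleGraph V} {t : ℝ} (ht : 0 < t) (ht1 : t < 1) (l₂ : List V)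
    (hc2 : l₂.IsChain G.Adj) (l : List V) :
    ∀ m, (∀ a ∈ l.head?, ∀ b ∈ l₂.head?, RD G a b m) → l.IsChain G.Adj → l.Disjoint l₂ →
      t ^ m * hA t l.length * hA t l₂.length ≤ crs (gf G t) l l₂ := by
  induction l with
  | nil => intros; simp [hA, crs]
  | cons a l ih =>
    intro m h hc hu
    have h0 := h a (by simp)
    have hc' := List.isChain_cons.1 hc
    have h1 := chain_from ht ht1 a l₂ m h0 hc2 (fun e => hu (by simp) e)
    have h2 := ih (m + 1) (fun b hb c hcc => ((h0 c hcc).symm.step (hc'.1 b hb)).symm) hc'.2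
      (fun x hx hx2 => hu (by simp [hx]) hx2)
    simp only [List.length_cons, hA, crs, List.map_cons, List.sum_cons]
    unfold crs at h2
    rw [pow_succ] at h2
    linarith

lemma chain_inside {G : SimpleGraph V} {t : ℝ} (ht : 0 < t) (ht1 : t < 1) (l : List V)
    (hc : l.IsChain G.Adj) (hn : l.Nodup) : hI t l.length ≤ ps (gf G t) l := by
  induction l with
  | nil => simp [hI, ps]
  | cons a l ih =>
    have hc' := List.isChain_cons.1 hc
    have hn' := List.nodup_cons.1 hn
    have h1 := chain_from ht ht1 a l 1 (fun b hb => RD.adj (hc'.1 b hb)) hc'.2 hn'.1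
    have h2 := ih hc'.2 hn'.2
    simp only [List.length_cons, hI, ps]
    linarith

structure LegS (G : SimpleGraph V) (ls : List (List V)) : Prop where
  nodup : ls.flatten.Nodup
  chain : ∀ l ∈ ls, l.IsChain G.Adj
  heads : ls.Pairwise (fun l l' => ∀ a ∈ l.head?, ∀ b ∈ l'.head?, G.Adj a b)

lemma crs_append_right (f : V → V → ℝ) (l m k : List V) :
    crs f l (m ++ k) = crs f l m + crs f l k := by
  simp only [crs, List.map_append, List.sum_append, List.sum_map_add]

lemma leg_cross {G : SimpleGraph V} {t : ℝ} (ht : 0 < t) (ht1 : t < 1) (l : List V)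
    (hc : l.IsChain G.Adj) (ls : List (List V)) (h1 : ∀ l' ∈ ls, l'.IsChain G.Adj)
    (h2 : ∀ l' ∈ ls, ∀ a ∈ l.head?, ∀ b ∈ l'.head?, G.Adj a b)
    (hd : ∀ l' ∈ ls, l.Disjoint l') :
    t * hA t l.length * sA t (ls.map List.length) ≤ crs (gf G t) l ls.flatten := by
  induction ls with
  | nil => simp [crs]
  | cons l' ls ih =>
    have e1 := ih (fun x hx => h1 x (by simp [hx])) (fun x hx => h2 x (by simp [hx]))
      (fun x hx => hd x (by simp [hx]))
    have e2 := chain_cross ht ht1 l' (h1 l' (by simp)) l 1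
      (fun a ha b hb => RD.adj (h2 l' (by simp) a ha b hb)) hc (hd l' (by simp))
    simp only [List.flatten_cons, crs_append_right, List.map_cons, sA_cons]
    linarith

lemma LegS.tail {G : SimpleGraph V} {l : List V} {ls : List (List V)} (h : LegS G (l :: ls)) :
    LegS G ls :=
  ⟨(List.nodup_append.1 (by simpa using h.nodup)).2.1, fun x hx => h.chain x (by simp [hx]),
    (List.pairwise_cons.1 h.heads).2⟩

lemma LegS.lower {G : SimpleGraph V} {t : ℝ} (ht : 0 < t) (ht1 : t < 1) (ls : List (List V))
    (h : LegS G ls) : hV t (ls.map List.length) ≤ ps (gf G t) ls.flatten := by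
  induction ls with
  | nil => simp [hV, ps]
  | cons l ls ih =>
    have e1 := ih h.tail
    have hn := List.nodup_append.1 (show (l ++ ls.flatten).Nodup by simpa using h.nodup)
    have e2 := chain_inside ht ht1 l (h.chain l (by simp)) hn.1
    have e3 := leg_cross ht ht1 l (h.chain l (by simp)) ls (fun x hx => h.chain x (by simp [hx]))
      (List.pairwise_cons.1 h.heads).1
      (fun l' hl' x hx hx' => hn.2.2 x hx x (List.mem_flatten.2 ⟨l', hl', hx'⟩) rfl)
    simp only [List.map_cons, hV, List.flatten_cons, ps_append]
    linarith

lemma LegS.perm {G : SimpleGraph V} {ls ls' : List (List V)} (h : LegS G ls)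
    (hp : ls.Perm ls') : LegS G ls' := by
  refine ⟨(hp.flatten.nodup_iff).1 h.nodup, fun l hl => h.chain l (hp.mem_iff.2 hl), ?_⟩
  refine (hp.pairwise_iff ?_).1 h.heads
  intro x y hxy a ha b hb
  exact (hxy b hb a ha).symm

lemma LegS.pad {G : SimpleGraph V} {ls : List (List V)} (h : LegS G ls) (z : ℕ) :
    LegS G (ls ++ List.replicate z []) := by
  refine ⟨by simpa using h.nodup, ?_, ?_⟩
  · intro l hl
    rcases List.mem_append.1 hl with hl | hl
    · exact h.chain l hl
    · rw [List.eq_of_mem_replicate hl]; exact List.isChain_nil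
  · rw [List.pairwise_append]
    refine ⟨h.heads, ?_, ?_⟩
    · rw [List.pairwise_replicate]
      right; simp
    · intro a _ b hb
      rw [List.eq_of_mem_replicate hb]
      simp

lemma LegS.resplit {G : SimpleGraph V} {l₀ l₁ : List V} (h : LegS G [l₀, l₁]) {a b : ℕ}
    (hab : a + b = l₀.length + l₁.length) :
    ∃ l₂ l₃, LegS G [l₂, l₃] ∧ l₂.length = a ∧ l₃.length = b ∧
      [l₂, l₃].flatten.Perm [l₀, l₁].flatten := by
  have hc : (l₀.reverse ++ l₁).IsChain G.Adj := by
    rw [List.isChain_append]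
    refine ⟨?_, h.chain _ (by simp), ?_⟩
    · rw [List.isChain_reverse]
      exact (h.chain l₀ (by simp)).imp (fun _ _ h => h.symm)
    · have := h.heads
      simpa using this
  set P := l₀.reverse ++ l₁ with hP
  have hlen : P.length = a + b := by simp [hP, hab]
  have hperm : [(P.take a).reverse, P.drop a].flatten.Perm [l₀, l₁].flatten := by
    simp only [List.flatten_cons, List.flatten_nil, List.append_nil]
    refine ((List.reverse_perm _).append_right _).trans ?_
    rw [List.take_append_drop]
    exact (List.reverse_perm _).append_right _
  refine ⟨(P.take a).reverse, P.drop a, ⟨hperm.nodup_iff.2 h.nodup, ?_, ?_⟩, ?_, ?_, hperm⟩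
  · rw [← List.take_append_drop a P, List.isChain_append] at hc
    intro l hl
    simp only [List.mem_cons, List.not_mem_nil, or_false] at hl
    rcases hl with rfl | rfl
    · rw [List.isChain_reverse]
      exact hc.1.imp (fun _ _ h => h.symm)
    · exact hc.2.1
  · rw [← List.take_append_drop a P, List.isChain_append] at hc
    simpa using hc.2.2
  · simp; omega
  · simp; omega

lemma exists_perm_map {α β : Type*} (f : α → β) (l : List α) (m : List β) (h : (l.map f).Perm m) :
    ∃ l' : List α, l.Perm l' ∧ l'.map f = m := by
  generalize hk : l.map f = k at h
  induction h generalizing l with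
  | nil => exact ⟨l, List.Perm.refl _, hk⟩
  | cons x h ih =>
    cases l with
    | nil => simp at hk
    | cons a l =>
      simp only [List.map_cons, List.cons.injEq] at hk
      obtain ⟨l', h1, h2⟩ := ih l hk.2
      exact ⟨a :: l', h1.cons a, by simp [hk.1, h2]⟩
  | swap x y L =>
    match l, hk with
    | a :: b :: l, hk =>
      simp only [List.map_cons, List.cons.injEq] at hk
      exact ⟨b :: a :: l, List.Perm.swap _ _ _, by simp [hk]⟩
  | trans _ _ ih1 ih2 =>
    obtain ⟨l1, h1, h2⟩ := ih1 l hk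
    obtain ⟨l2, h3, h4⟩ := ih2 l1 h2
    exact ⟨l2, h1.trans h3, h4⟩

/-- transporting a leg structure to another one of the same shape -/
lemma LegS.transport {W : Type*} [DecidableEq W] {G : SimpleGraph V} {ls : List (List V)}
    (h : LegS G ls) (hcov : ∀ v, v ∈ ls.flatten) {ms : List (List W)} (hn : ms.flatten.Nodup)
    (hcov' : ∀ v, v ∈ ms.flatten) (hlen : (ls.map List.length).Perm (ms.map List.length)) :
    ∃ e : W ≃ V, LegS (G.comap e) ms := by
  obtain ⟨ls', hp, hl⟩ := exists_perm_map _ _ _ hlen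
  have h' := h.perm hp
  have hcv : ∀ v, v ∈ ls'.flatten := fun v => (hp.flatten.mem_iff).1 (hcov v)
  have hL : ls'.flatten.length = ms.flatten.length := by
    rw [List.length_flatten, List.length_flatten, hl]
  set F := ls'.flatten with hF
  set M := ms.flatten with hM
  have hlt : ∀ w, M.idxOf w < F.length := fun w => by
    rw [hL]; exact List.idxOf_lt_length_iff.2 (hcov' w)
  let ψ : W → V := fun w => F[M.idxOf w]'(hlt w)
  have hinj : Function.Injective ψ := by
    intro a b hab
    have := (h'.nodup.getElem_inj_iff).1 hab
    exact (List.idxOf_inj (hcov' a)).1 this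
  have hmap : M.map ψ = F := by
    apply List.ext_getElem
    · simp [hL]
    · intro i h1 h2
      simp only [List.getElem_map, ψ]
      congr 1
      exact hn.idxOf_getElem i _
  have hsurj : Function.Surjective ψ := by
    intro v
    have := hcv v
    rw [← hmap, List.mem_map] at this
    obtain ⟨w, _, hw⟩ := this
    exact ⟨w, hw⟩
  have hms : ms.map (List.map ψ) = ls' := by
    rw [List.eq_iff_flatten_eq]
    constructor
    · rw [← List.map_flatten]; exact hmap
    · rw [hl, List.map_map]
      apply List.map_congr_left
      simp
  refine ⟨Equiv.ofBijective ψ ⟨hinj, hsurj⟩, hn, ?_, ?_⟩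
  · intro l hl'
    have := h'.chain (l.map ψ) (by rw [← hms]; exact List.mem_map_of_mem hl')
    rw [List.isChain_map] at this
    exact this
  · have := h'.heads
    rw [← hms, List.pairwise_map] at this
    refine this.imp ?_
    intro l l' hh a ha b hb
    exact hh (ψ a) (by simp only [List.head?_map, Option.mem_def] at *; simp [ha]) (ψ b) (by simp only [List.head?_map, Option.mem_def] at *; simp [hb])

/-! ### total sums -/

lemma gf_comm (G : SimpleGraph V) (t : ℝ) (u v : V) : gf G t u v = gf G t v u := by
  simp only [gf]
  rw [dist_comm]

lemma gf_self (G : SimpleGraph V) (t : ℝ) (u : V) : gf G t u u = 0 := by simp [gf]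

lemma gf_mono {G H : SimpleGraph V} (hGH : G ≤ H) {t : ℝ} (ht : 0 < t) (ht1 : t < 1) (u v : V) :
    gf G t u v ≤ gf H t u v := by
  by_cases hr : G.Reachable u v
  · by_cases huv : u = v
    · subst huv; simp [gf_self]
    · obtain ⟨p, hp⟩ := hr.exists_walk_length_eq_dist
      have hd : H.dist u v ≤ G.dist u v := by
        have := dist_le (p.mapLe hGH)
        simpa [hp] using this
      have h1 : RD H u v (G.dist u v) := ⟨hr.mono hGH, hd⟩
      have h2 := h1.le_gf ht ht1 huv
      unfold gf at h2 ⊢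
      have := hr.pos_dist_of_ne huv
      rwa [if_neg (show G.dist u v ≠ 0 by omega)]
  · have : gf G t u v = 0 := by
      unfold gf
      rw [if_pos (dist_eq_zero_of_not_reachable hr)]
    rw [this]
    exact gf_nonneg H ht u v

noncomputable def tot [Fintype V] (G : SimpleGraph V) (t : ℝ) : ℝ := ∑ u, ∑ v, gf G t u v

lemma tot_mono [Fintype V] {G H : SimpleGraph V} (hGH : G ≤ H) {t : ℝ} (ht : 0 < t) (ht1 : t < 1) :
    tot G t ≤ tot H t :=
  Finset.sum_le_sum fun u _ => Finset.sum_le_sum fun v _ => gf_mono hGH ht ht1 u v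

lemma tot_strict [Fintype V] {G H : SimpleGraph V} (hGH : G ≤ H) (hne : G ≠ H) {t : ℝ}
    (ht : 0 < t) (ht1 : t < 1) : tot G t < tot H t := by
  have : ∃ u v, H.Adj u v ∧ ¬ G.Adj u v := by
    by_contra hcon
    push Not at hcon
    exact hne (le_antisymm hGH (fun u v h => hcon u v h))
  obtain ⟨u, v, h1, h2⟩ := this
  have h3 : gf G t u v < gf H t u v := by
    refine (gf_lt ht ht1 h2).trans_le ?_
    simpa using (RD.adj h1).le_gf ht ht1 h1.ne
  refine Finset.sum_lt_sum (fun u _ => Finset.sum_le_sum fun v _ => gf_mono hGH ht ht1 u v)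
    ⟨u, Finset.mem_univ _, Finset.sum_lt_sum (fun v _ => gf_mono hGH ht ht1 u v)
      ⟨v, Finset.mem_univ _, h3⟩⟩

lemma dist_iso {W : Type*} {G : SimpleGraph V} {H : SimpleGraph W} (e : G ≃g H) (u v : V) :
    H.dist (e u) (e v) = G.dist u v := by
  have key : ∀ {X Y : Type _} {A : SimpleGraph X} {B : SimpleGraph Y} (f : A ≃g B) (x y : X),
      A.Reachable x y → B.dist (f x) (f y) ≤ A.dist x y := by
    intro X Y A B f x y hr
    obtain ⟨p, hp⟩ := hr.exists_walk_length_eq_dist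
    have := dist_le (p.map f.toHom)
    rw [Walk.length_map, hp] at this
    exact this
  by_cases hr : G.Reachable u v
  · apply le_antisymm (key e u v hr)
    have hr2 : H.Reachable (e u) (e v) := hr.map e.toHom
    obtain ⟨p, hp⟩ := hr2.exists_walk_length_eq_dist
    have := dist_le (p.map e.symm.toHom)
    rw [Walk.length_map, hp] at this
    simpa using this
  · have : ¬ H.Reachable (e u) (e v) := fun h => hr (by simpa using h.map e.symm.toHom)
    rw [dist_eq_zero_of_not_reachable hr, dist_eq_zero_of_not_reachable this]

lemma tot_iso {W : Type*} [Fintype V] [Fintype W] {G : SimpleGraph V} {H : SimpleGraph W}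
    (e : G ≃g H) (t : ℝ) : tot G t = tot H t := by
  unfold tot
  refine Fintype.sum_equiv e.toEquiv _ _ fun u => Fintype.sum_equiv e.toEquiv _ _ fun v => ?_
  have := dist_iso e u v
  simp only [gf]
  change _ = if H.dist (e u) (e v) = 0 then 0 else t ^ H.dist (e u) (e v)
  rw [this]

lemma crs_self (f : V → V → ℝ) (hs : ∀ u v, f u v = f v u) (h0 : ∀ u, f u u = 0) (l : List V) :
    crs f l l = 2 * ps f l := by
  induction l with
  | nil => simp [crs, ps]
  | cons a l ih =>
    have : crs f l (a :: l) = (l.map (f a)).sum + crs f l l := by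
      simp only [crs, List.map_cons, List.sum_cons, List.sum_map_add]
      congr 2
      exact List.map_congr_left fun x _ => hs x a
    have h2 : crs f (a :: l) (a :: l) = f a a + (l.map (f a)).sum + crs f l (a :: l) := by
      simp [crs]
    rw [h2, this, ih, h0]
    simp only [ps]
    ring

lemma sum_univ_list [Fintype V] (l : List V) (hn : l.Nodup) (hc : ∀ v, v ∈ l) (f : V → ℝ) :
    ∑ v, f v = (l.map f).sum := by
  classical
  rw [← List.sum_toFinset f hn]
  congr 1
  ext v; simp [hc]

lemma tot_eq [Fintype V] (G : SimpleGraph V) (t : ℝ) (l : List V) (hn : l.Nodup)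
    (hc : ∀ v, v ∈ l) : tot G t = 2 * ps (gf G t) l := by
  rw [← crs_self _ (gf_comm G t) (gf_self G t), tot]
  simp only [sum_univ_list l hn hc]
  rfl

lemma length_cover [Fintype V] (l : List V) (hn : l.Nodup) (hc : ∀ v, v ∈ l) :
    l.length = Fintype.card V := by
  classical
  rw [← List.toFinset_card_of_nodup hn, ← Finset.card_univ]
  congr 1
  ext v; simp [hc]

end Legs

/-! ### The legs of `GNK` -/

lemma gnkOwner_eq {n k : ℕ} (hk : k < n) (j : ℕ) : gnkOwner n k j = j % (n - k) := by
  unfold gnkOwner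
  split_ifs with h
  · exact (Nat.mod_eq_of_lt h).symm
  · rw [← Nat.mod_eq_sub_mod (by omega)]

lemma gnkDepth_eq {n k : ℕ} (hk : k < n) (j : ℕ) : gnkDepth n k j = j / (n - k) := by
  unfold gnkDepth
  split_ifs with h
  · exact (Nat.div_eq_of_lt h).symm
  · rw [Nat.div_eq_sub_div (a := j) (by omega) (by omega)]

lemma gnk_legs (n k : ℕ) (hk : k + 2 ≤ n) :
    ∃ ms : List (List (Fin n)), ms.length = n - k ∧ (∀ v, v ∈ ms.flatten) ∧
      LBal (ms.map List.length) ∧ LegS (GNK n k) ms ∧ ∀ H, LegS H ms → GNK n k ≤ H := by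
  obtain ⟨p, hp⟩ : ∃ p, n - k = p := ⟨_, rfl⟩
  have hp2 : 2 ≤ p := by omega
  have hpn : p ≤ n := by omega
  have hadj : ∀ a b : Fin n, (GNK n k).Adj a b ↔ a ≠ b ∧
      ((((a : ℕ) / p = 0 ∧ (b : ℕ) / p = 0) ∨ ((a : ℕ) % p = b % p ∧ (a : ℕ) / p + 1 = b / p)) ∨
      (((b : ℕ) / p = 0 ∧ (a : ℕ) / p = 0) ∨
        ((b : ℕ) % p = a % p ∧ (b : ℕ) / p + 1 = a / p))) := by
    intro a b
    simp only [GNK, fromRel_adj, gnkOwner_eq (show k < n by omega),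
      gnkDepth_eq (show k < n by omega), hp]
  let m : Fin p → ℕ := fun i => (n - 1 - i) / p + 1
  have hm : ∀ (i : Fin p) (x : ℕ), x < m i ↔ x * p + i < n := by
    intro i x
    simp only [m]
    rw [Nat.lt_succ_iff, Nat.le_div_iff_mul_le (by omega)]
    have := i.2
    omega
  let leg : Fin p → List (Fin n) := fun i =>
    List.ofFn (fun x : Fin (m i) => (⟨x * p + i, (hm i x).1 x.2⟩ : Fin n))
  have hdiv : ∀ (i : Fin p) (x : ℕ), (x * p + i) / p = x := fun i x => by
    rw [Nat.mul_comm, Nat.mul_add_div (by omega), Nat.div_eq_of_lt i.2, add_zero]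
  have hmod : ∀ (i : Fin p) (x : ℕ), (x * p + i) % p = i := fun i x => by
    rw [Nat.mul_comm, Nat.mul_add_mod, Nat.mod_eq_of_lt i.2]
  have hlen : ∀ i, (leg i).length = m i := fun i => List.length_ofFn
  have hget : ∀ i (x : ℕ) (hx : x < (leg i).length), (((leg i)[x] : Fin n) : ℕ) = x * p + i := by
    intro i x hx
    simp only [leg, List.getElem_ofFn]
  have hmem : ∀ i v, v ∈ leg i ↔ (v : ℕ) % p = i := by
    intro i v
    rw [List.mem_ofFn]
    constructor
    · rintro ⟨x, rfl⟩
      exact hmod i x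
    · intro h
      have e : (v : ℕ) / p * p + i = v := by
        rw [← h, Nat.mul_comm]; exact Nat.div_add_mod _ _
      exact ⟨⟨v / p, (hm i _).2 (by rw [e]; exact v.2)⟩, Fin.ext e⟩
  have hhead : ∀ i, (leg i).head? = some ⟨i, by have := i.2; omega⟩ := by
    intro i
    have h0 : 0 < (leg i).length := by rw [hlen]; simp [m]
    rw [List.head?_eq_getElem?, List.getElem?_eq_getElem h0]
    congr 1
    ext
    rw [hget]; simp
  refine ⟨List.ofFn leg, by simp [hp], ?_, ?_, ⟨?_, ?_, ?_⟩, ?_⟩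
  · intro v
    rw [List.mem_flatten]
    let i : Fin p := ⟨v % p, Nat.mod_lt _ (by omega)⟩
    exact ⟨leg i, List.mem_ofFn.2 ⟨i, rfl⟩, (hmem i v).2 rfl⟩
  · intro a ha b hb
    rw [List.map_ofFn, List.mem_ofFn] at ha hb
    obtain ⟨i, rfl⟩ := ha
    obtain ⟨j, rfl⟩ := hb
    simp only [Function.comp, hlen, m]
    have h1 : (n - 1 - (i : ℕ)) / p ≤ (n - 1 - (j : ℕ) + p) / p :=
      Nat.div_le_div_right (by have := i.2; have := j.2; omega)
    rw [Nat.add_div_right _ (by omega)] at h1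
    omega
  · rw [List.nodup_flatten]
    constructor
    · intro l hl
      obtain ⟨i, rfl⟩ := List.mem_ofFn.1 hl
      rw [List.nodup_ofFn]
      intro x y hxy
      simp only [Fin.mk.injEq] at hxy
      have := congrArg (· / p) hxy
      simp only [hdiv] at this
      exact Fin.ext this
    · rw [List.pairwise_ofFn]
      intro i j hij v hv hv'
      rw [hmem] at hv hv'
      have : i = j := Fin.ext (hv.symm.trans hv')
      omega
  · intro l hl
    obtain ⟨i, rfl⟩ := List.mem_ofFn.1 hl
    rw [List.isChain_iff_getElem]
    intro x hx
    rw [hadj]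
    simp only [hget, hdiv, hmod]
    refine ⟨?_, by simp⟩
    intro h
    have := congrArg Fin.val h
    rw [hget, hget] at this
    have := congrArg (· / p) this
    simp only [hdiv] at this
    omega
  · rw [List.pairwise_ofFn]
    intro i j hij a ha b hb
    rw [hhead] at ha hb
    simp only [Option.mem_def, Option.some.injEq] at ha hb
    subst ha; subst hb
    rw [hadj]
    refine ⟨?_, Or.inl (Or.inl ⟨Nat.div_eq_of_lt i.2, Nat.div_eq_of_lt j.2⟩)⟩
    intro h
    have := congrArg Fin.val h
    simp only at this
    have : (i : ℕ) < j := hij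
    omega
  · intro H hH
    have key1 : ∀ a b : Fin n, a < b → (a : ℕ) / p = 0 → (b : ℕ) / p = 0 → H.Adj a b := by
      intro a b hab ha hb
      have ha' : (a : ℕ) < p := by
        rcases (Nat.div_eq_zero_iff).1 ha with h | h <;> omega
      have hb' : (b : ℕ) < p := by
        rcases (Nat.div_eq_zero_iff).1 hb with h | h <;> omega
      have := (List.pairwise_ofFn.1 hH.heads) (i := ⟨a, ha'⟩) (j := ⟨b, hb'⟩) hab
      exact this a (by rw [hhead]; rfl) b (by rw [hhead]; rfl)
    have key2 : ∀ a b : Fin n, (a : ℕ) % p = b % p → (a : ℕ) / p + 1 = b / p → H.Adj a b := by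
      intro a b h1 h2
      let i : Fin p := ⟨a % p, Nat.mod_lt _ (by omega)⟩
      have hc := hH.chain (leg i) (List.mem_ofFn.2 ⟨i, rfl⟩)
      rw [List.isChain_iff_getElem] at hc
      have ea : (a : ℕ) / p * p + a % p = a := by
        rw [Nat.mul_comm]; exact Nat.div_add_mod _ _
      have eb : ((a : ℕ) / p + 1) * p + a % p = b := by
        rw [h1, h2, Nat.mul_comm]; exact Nat.div_add_mod _ _
      have hx : (a : ℕ) / p + 1 < (leg i).length := by
        rw [hlen, hm]
        exact eb.trans_lt b.2
      have := hc (a / p) hx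
      have e1 : (leg i)[(a : ℕ) / p] = a := Fin.ext ((hget _ _ _).trans ea)
      have e2 : (leg i)[(a : ℕ) / p + 1] = b := Fin.ext ((hget _ _ _).trans eb)
      rwa [e1, e2] at this
    intro a b h
    rw [hadj] at h
    obtain ⟨hne, h⟩ := h
    have key1' : ∀ a b : Fin n, a ≠ b → (a : ℕ) / p = 0 → (b : ℕ) / p = 0 → H.Adj a b := by
      intro a b hne h1 h2
      rcases lt_or_gt_of_ne hne with h | h
      · exact key1 a b h h1 h2
      · exact (key1 b a h h2 h1).symm
    rcases h with (h | h) | (h | h)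
    · exact key1' a b hne h.1 h.2
    · exact key2 a b h.1 h.2
    · exact key1' a b hne h.2 h.1
    · exact (key2 b a h.1 h.2).symm

/-! ### The upper bound for a fixed `t` -/

section Upper

variable {V : Type*}

lemma labels_path (l : List V) : (Fo.path l).labels = l := by
  induction l with
  | nil => rfl
  | cons a l ih => simp [Fo.path, Fo.labels, ih]

lemma labels_legs (ls : List (List V)) : (Fo.legs ls).labels = ls.flatten := by
  induction ls with
  | nil => rfl
  | cons l ls ih =>
    cases l with
    | nil => simp [Fo.legs, ih]
    | cons a l => simp [Fo.legs, Fo.labels, ih, labels_path]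

lemma labels_broom (st : List V) (ls : List (List V)) :
    (Fo.broom st ls).labels = st ++ ls.flatten := by
  induction st with
  | nil => simp [Fo.broom, labels_legs]
  | cons a st ih => simp [Fo.broom, Fo.labels, ih]

lemma roots_path (l : List V) : (Fo.path l).roots = l.head?.toList := by
  cases l with
  | nil => rfl
  | cons a l => simp [Fo.path, Fo.roots]

lemma roots_legs (ls : List (List V)) (x : V) :
    x ∈ (Fo.legs ls).roots ↔ ∃ l ∈ ls, x ∈ l.head? := by
  induction ls with
  | nil => simp [Fo.legs, Fo.roots]
  | cons l ls ih =>
    cases l with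
    | nil => simp [Fo.legs, ih]
    | cons a l => simp [Fo.legs, Fo.roots, ih, eq_comm]

lemma path_chain {G : SimpleGraph V} (l : List V) (h : FCompl G (Fo.path l)) :
    l.IsChain G.Adj := by
  induction l with
  | nil => exact List.isChain_nil
  | cons a l ih =>
    obtain ⟨h1, _, h3, _⟩ := h
    rw [List.isChain_cons]
    refine ⟨fun b hb => h1 b ?_, ih h3⟩
    rw [roots_path]
    simpa using hb

lemma legs_LegS {G : SimpleGraph V} (ls : List (List V)) (h : FCompl G (Fo.legs ls))
    (hn : ls.flatten.Nodup) : LegS G ls := by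
  refine ⟨hn, ?_, ?_⟩
  · clear hn
    induction ls with
    | nil => simp
    | cons l ls ih =>
      cases l with
      | nil =>
        intro l hl
        rcases List.mem_cons.1 hl with rfl | hl
        · exact List.isChain_nil
        · exact ih h l hl
      | cons a l =>
        obtain ⟨h1, h2, h3, h4⟩ := h
        intro l' hl
        rcases List.mem_cons.1 hl with rfl | hl
        · rw [List.isChain_cons]
          refine ⟨fun b hb => h1 b ?_, path_chain l h3⟩
          rw [roots_path]
          simpa using hb
        · exact ih h4 l' hl
  · clear hn
    induction ls with
    | nil => simp
    | cons l ls ih =>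
      cases l with
      | nil =>
        rw [List.pairwise_cons]
        exact ⟨by simp, ih h⟩
      | cons a l =>
        obtain ⟨h1, h2, h3, h4⟩ := h
        rw [List.pairwise_cons]
        refine ⟨?_, ih h4⟩
        intro l' hl' x hx b hb
        simp only [List.head?_cons, Option.mem_def, Option.some.injEq] at hx
        subst hx
        exact h2 b ((roots_legs ls b).2 ⟨l', hl', hb⟩)

lemma broom_stem {G : SimpleGraph V} (ls : List (List V)) (st : List V) :
    ∀ (u : V) (acc : List V), FCompl G (Fo.broom st ls) →
      (∀ c ∈ (Fo.broom st ls).roots, G.Adj u c) → (u :: acc).IsChain G.Adj →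
      FCompl G (Fo.legs ls) ∧ (st.reverse ++ u :: acc).IsChain G.Adj ∧
        ∀ x ∈ (st.reverse ++ u :: acc).head?, ∀ c ∈ (Fo.legs ls).roots, G.Adj x c := by
  induction st with
  | nil =>
    intro u acc h1 h2 h3
    refine ⟨h1, h3, ?_⟩
    intro x hx
    simp only [List.reverse_nil, List.nil_append, List.head?_cons, Option.mem_def,
      Option.some.injEq] at hx
    subst hx
    exact h2
  | cons a st ih =>
    intro u acc h1 h2 h3
    obtain ⟨e1, _, e3, _⟩ := h1
    have hua : G.Adj u a := h2 a (by simp [Fo.broom, Fo.roots])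
    have := ih a (u :: acc) e3 e1 (by
      rw [List.isChain_cons_cons]
      exact ⟨hua.symm, h3⟩)
    simpa using this

lemma broom_LegS {G : SimpleGraph V} {r : V} {st : List V} {ls : List (List V)}
    (h : FCompl G (Fo.broom st ls)) (hr : ∀ c ∈ (Fo.broom st ls).roots, G.Adj r c)
    (hn : (r :: (Fo.broom st ls).labels).Nodup) :
    LegS G ((st.reverse ++ [r]) :: ls) ∧
      ((st.reverse ++ [r]) :: ls).flatten.Perm (r :: (Fo.broom st ls).labels) := by
  have hp : ((st.reverse ++ [r]) :: ls).flatten.Perm (r :: (Fo.broom st ls).labels) := by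
    rw [labels_broom, List.flatten_cons, ← List.cons_append]
    apply List.Perm.append_right
    exact (List.perm_append_singleton r _).trans ((List.reverse_perm st).cons r)
  obtain ⟨h1, h2, h3⟩ := broom_stem ls st r [] h hr (List.isChain_singleton r)
  have hn' : ls.flatten.Nodup := by
    rw [labels_broom, ← List.cons_append] at hn
    exact (List.nodup_append.1 hn).2.1
  have hL := legs_LegS ls h1 hn'
  refine ⟨⟨hp.nodup_iff.2 hn, ?_, ?_⟩, hp⟩
  · intro l hl
    rcases List.mem_cons.1 hl with rfl | hl
    · exact h2
    · exact hL.chain l hl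
  · rw [List.pairwise_cons]
    refine ⟨?_, hL.heads⟩
    intro l' hl' a ha b hb
    exact h3 a ha b ((roots_legs ls b).2 ⟨l', hl', hb⟩)

lemma hV_pad (t : ℝ) (L : List ℕ) (z : ℕ) : hV t (L ++ List.replicate z 0) = hV t L := by
  have h : sA t (List.replicate z 0) = 0 ∧ hV t (List.replicate z 0) = 0 := by
    induction z with
    | zero => simp [hV]
    | succ z ih => simp [List.replicate_succ, hV, ih, hA, hI]
  rw [hV_append, h.1, h.2]; ring

lemma bW_top (t : ℝ) (s : ℕ) (L : List ℕ) :
    bW t s L + t * 1 * bA t s L = hV t ((s + 1) :: L) := by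
  have := hA_succ' t s
  simp only [bW, bA, hV, this]
  simp only [hI]
  ring

lemma upper [Fintype V] {G : SimpleGraph V} (hc : G.Connected) {n k : ℕ} (hk : k + 2 ≤ n)
    (hcard : Fintype.card V = n) {r : V} (hr : ¬ CutS G r) (S : Finset V)
    (hS : ∀ v ∈ S, CutS G v) (hSk : k ≤ S.card) {M : List ℕ} (hM : LBal M)
    (hMl : M.length = n - k) (hMs : M.sum = n) {t : ℝ} (ht : 0 < t) (ht1 : t < 1) :
    tot G t < 2 * hV t M ∨
      (tot G t ≤ 2 * hV t M ∧
        ∃ ls, LegS G ls ∧ (∀ v, v ∈ ls.flatten) ∧ (ls.map List.length).Perm M) := by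
  classical
  obtain ⟨par, dep, D⟩ := exists_DTree hc r
  let ch : V → List V := fun x => (Finset.univ.filter (fun v => v ≠ r ∧ par v = x)).toList
  have hch : ∀ x v, v ∈ ch x ↔ v ≠ r ∧ par v = x := by intro x v; simp [ch]
  have hchn : ∀ x, (ch x).Nodup := fun x => Finset.nodup_toList _
  have hok := fo_ok hc D ch hch hchn ht ht1 (Nat.card V) r (by omega) (ch r) (hchn r)
    (fun c h => (hch r c).1 h)
  set T := fo ch (Nat.card V) (ch r) with hT
  have hdep1 : ∀ c ∈ ch r, dep c = 1 := by
    intro c hcr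
    obtain ⟨h1, h2⟩ := (hch r c).1 hcr
    have := D.dep_par c h1
    rw [h2, D.dep_r] at this
    exact this
  have hdep : ∀ x ∈ T.labels, 1 ≤ dep x := by
    intro x hx
    obtain ⟨c, hcr, hcx⟩ := (hok.mem x).1 hx
    have := hdep1 c hcr
    have := hcx.1
    omega
  have hrn : r ∉ T.labels := by
    intro h
    have := hdep r h
    rw [D.dep_r] at this
    omega
  have hnod : (r :: T.labels).Nodup := List.nodup_cons.2 ⟨hrn, hok.nodup⟩
  have hcov : ∀ v, v ∈ r :: T.labels := by
    intro v
    by_cases hv : v = r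
    · simp [hv]
    · apply List.mem_cons_of_mem
      rw [hok.mem]
      have hanc : Anc par dep r v := by
        refine ⟨by rw [D.dep_r]; omega, ?_⟩
        rw [D.dep_r, Nat.sub_zero]
        apply D.dep_zero
        rw [D.dep_iter _ _ le_rfl]; omega
      obtain ⟨d, h1, h2, h3⟩ := D.anc_child hanc hv
      exact ⟨d, (hch r d).2 ⟨h1, h2⟩, h3⟩
  have hlen := length_cover _ hnod hcov
  rw [List.length_cons, hcard] at hlen
  have hTne : T ≠ Fo.nil := by
    intro h
    rw [h] at hlen
    simp [Fo.labels] at hlen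
    omega
  -- counting leaves
  have hleaf : T.leaves + 1 ≤ n - k := by
    rw [hok.hleaves]
    have h1 := List.length_eq_countP_add_countP (fun x => (ch x).isEmpty) (l := T.labels)
    have h2 : k ≤ T.labels.countP (fun a => decide ¬ ((ch a).isEmpty = true)) := by
      rw [List.countP_eq_length_filter]
      refine hSk.trans (le_trans (Finset.card_le_card ?_) (List.toFinset_card_le _))
      intro v hv
      rw [List.mem_toFinset, List.mem_filter]
      have hvr : v ≠ r := by
        rintro rfl
        exact hr (hS v hv)
      refine ⟨(List.mem_cons.1 (hcov v)).resolve_left hvr, ?_⟩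
      obtain ⟨w, h3, h4⟩ := D.cut v hvr (hS v hv)
      have : w ∈ ch v := (hch v w).2 ⟨h3, h4⟩
      simp only [List.isEmpty_iff, decide_eq_true_eq]
      intro he
      rw [he] at this
      simp at this
    omega
  -- root sum
  have hroot := sum_le_or T.labels T.roots (gf G t r) (fun x => t * t ^ (dep x - (dep r + 1)))
    (fun x => G.Adj r x)
    (fun x hx => by
      rw [hok.hroots] at hx
      exact (hok.mem x).2 ⟨x, hx, anc_self x⟩)
    (fun x hx => by
      rw [← pow_succ']
      apply gf_le ht ht1
      have h1 := D.dist_anc hc r x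
      have h2 := hdep x hx
      rw [D.dep_r] at h1 ⊢
      omega)
    (fun x hx h => by
      rw [hok.hroots] at hx
      simp only [hdep1 x hx, D.dep_r]
      simpa using gf_lt ht ht1 h)
  rw [List.sum_map_mul_left, ← hok.hA] at hroot
  have htot := tot_eq G t _ hnod hcov
  simp only [ps] at htot
  obtain ⟨s, L, hL1, hL2, hLv, hopt⟩ := forest_opt ht ht1 T 1 hTne
  rw [bW_top] at hopt
  let z := n - k - (L.length + 1)
  let N := (s + 1) :: L ++ List.replicate z 0
  have hNl : N.length = M.length := by
    simp [N, z, hMl]; omega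
  have hNs : N.sum = M.sum := by
    have := size_eq T
    simp [N, hMs]; omega
  have hNV : hV t N = hV t ((s + 1) :: L) := hV_pad t _ z
  have hNM := hV_le_bal ht ht1 hM _ N le_rfl hNl hNs
  have hpsle := hok.hps.elim le_of_lt (fun h => h.1)
  have hrle := hroot.elim le_of_lt (fun h => h.1)
  rcases hopt with hopt | ⟨hopt, st, ls, hTb, hst, hls⟩
  · left; linarith
  rcases hok.hps with hps | ⟨_, hcomp⟩
  · left; linarith
  rcases hroot with hroot | ⟨_, hadj⟩
  · left; linarith
  by_cases hNM' : hV t N < hV t M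
  · left; linarith
  right
  refine ⟨by linarith, ?_⟩
  rw [hTb] at hcomp hadj hnod hcov
  obtain ⟨hLS, hperm⟩ := broom_LegS hcomp hadj hnod
  have hLS' := hLS.pad z
  set ls' := (st.reverse ++ [r]) :: ls ++ List.replicate z [] with hls'
  have hmapN : ls'.map List.length = N := by
    simp [hls', N, hst, hls]
  have hcov' : ∀ v, v ∈ ls'.flatten := by
    intro v
    have : ls'.flatten = ((st.reverse ++ [r]) :: ls).flatten := by simp [hls']
    rw [this]
    exact hperm.mem_iff.2 (hcov v)
  by_cases hNb : LBal N
  · exact ⟨ls', hLS', hcov', hmapN ▸ bal_perm hNb hM hNl hNs⟩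
  have hNcount : 2 ≤ N.countP (fun x => decide (0 < x)) := by
    have h1 := hLv.1
    have h2 : L.countP (fun x => decide (0 < x)) = L.length := by
      rw [List.countP_eq_length]
      intro a ha
      simpa using hLv.2.1 a ha
    simp only [N, List.cons_append, List.countP_cons, List.countP_append, h2]
    simp
    omega
  by_cases h3 : 3 ≤ N.length
  · exact absurd (hV_lt_bal ht ht1 hM N hNl hNs h3 hNcount hNb) hNM'
  · have hM2 : M.length = 2 := by omega
    have hl2 : ls'.length = 2 := by
      rw [← List.length_map (f := List.length), hmapN]; omega
    obtain ⟨l₀, l₁, he⟩ := List.length_eq_two.1 hl2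
    obtain ⟨a, b, hMe⟩ := List.length_eq_two.1 hM2
    rw [he] at hLS' hcov' hmapN
    obtain ⟨l₂, l₃, h1, h2, h3, h4⟩ := hLS'.resplit (a := a) (b := b) (by
      have := hNs
      rw [← hmapN, hMe] at this
      simp at this
      omega)
    refine ⟨[l₂, l₃], h1, fun v => h4.mem_iff.2 (hcov' v), ?_⟩
    simp [h2, h3, hMe]

end Upper

/-- the comparison for a fixed `t` -/
lemma tot_main (n k : ℕ) (hk : k + 2 ≤ n) {V : Type*} [Fintype V]
    (G : SimpleGraph V) (hcard : Fintype.card V = n)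
    (hcut : {v | IsCutVertex G v}.ncard = k) (hiso : ¬ Nonempty (G ≃g GNK n k)) {t : ℝ}
    (ht : 0 < t) (ht1 : t < 1) : tot G t < tot (GNK n k) t := by
  classical
  obtain ⟨ms, hm1, hm2, hm3, hm4, hm5⟩ := gnk_legs n k hk
  have hnt : Nontrivial V := by
    rw [← Fintype.one_lt_card_iff_nontrivial]; omega
  obtain ⟨G', hGG, hc, hcut'⟩ := exists_connect G
  obtain ⟨r, hr⟩ := exists_not_cutS hc
  have hMs : (ms.map List.length).sum = n := by
    rw [← List.length_flatten, length_cover _ hm4.nodup hm2, Fintype.card_fin]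
  have hlow := hm4.lower ht ht1
  have htG := tot_eq (GNK n k) t _ hm4.nodup hm2
  have hS := upper hc hk hcard hr (Finset.univ.filter (fun v => IsCutVertex G v))
    (fun v hv => hcut' v (cutS_of_isCut (Finset.mem_filter.1 hv).2))
    (by
      rw [← hcut, Set.ncard_eq_toFinset_card']
      apply Finset.card_le_card
      intro v; simp)
    hm3 (by simp [hm1]) hMs ht ht1
  rcases hS with hS | ⟨hle, ls, h1, h2, h3⟩
  · have := tot_mono hGG ht ht1
    linarith
  · obtain ⟨e, he⟩ := h1.transport h2 hm4.nodup hm2 h3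
    have hle' := hm5 _ he
    have htc : tot (G'.comap e) t = tot G' t := tot_iso (Iso.comap e G') t
    have heq : GNK n k = G'.comap e := by
      by_contra hne
      have := tot_strict hle' hne ht ht1
      linarith
    have hne : G ≠ G' := by
      rintro rfl
      apply hiso
      rw [heq]
      exact ⟨(Iso.comap e G).symm⟩
    have := tot_strict hGG hne ht ht1
    rw [heq, htc]
    exact this

lemma harary_integral {V : Type*} [Fintype V] (G : SimpleGraph V) :
    hararyIndex G = ∫ t in (0 : ℝ)..1,
      (∑ u : V, ∑ v : V, if G.dist u v = 0 then (0 : ℝ) else t ^ (G.dist u v - 1)) / 2 := by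
  have hInt : ∀ u v : V, IntervalIntegrable
      (fun t : ℝ => if G.dist u v = 0 then (0 : ℝ) else t ^ (G.dist u v - 1))
      MeasureTheory.volume 0 1 := by
    intro u v
    apply Continuous.intervalIntegrable
    split_ifs <;> fun_prop
  rw [intervalIntegral.integral_div, intervalIntegral.integral_finsetSum]
  · unfold hararyIndex
    congr 1
    apply Finset.sum_congr rfl
    intro u _
    rw [intervalIntegral.integral_finsetSum (fun v _ => hInt u v)]
    apply Finset.sum_congr rfl
    intro v _
    split_ifs with h
    · simp [h]
    · rw [integral_pow]
      have h1 : G.dist u v - 1 + 1 = G.dist u v := by omega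
      have h2 : ((G.dist u v - 1 : ℕ) : ℝ) + 1 = G.dist u v := by exact_mod_cast h1
      rw [h1, h2]
      simp [h]
  · intro u _
    apply Continuous.intervalIntegrable
    apply continuous_finsetSum
    intro v _
    split_ifs <;> fun_prop

lemma tot_div {V : Type*} [Fintype V] (G : SimpleGraph V) {t : ℝ} (ht : 0 < t) :
    t * (∑ u : V, ∑ v : V, if G.dist u v = 0 then (0 : ℝ) else t ^ (G.dist u v - 1)) =
      tot G t := by
  simp only [tot, Finset.mul_sum, gf]
  refine Finset.sum_congr rfl fun u _ => Finset.sum_congr rfl fun v _ => ?_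
  split_ifs with h
  · simp
  · rw [← pow_succ']
    congr 1
    omega

lemma harary_lt {V W : Type*} [Fintype V] [Fintype W] (G : SimpleGraph V) (H : SimpleGraph W)
    (h : ∀ t : ℝ, 0 < t → t < 1 → tot G t < tot H t) : hararyIndex G < hararyIndex H := by
  rw [harary_integral, harary_integral]
  have hcont : ∀ {X : Type _} [Fintype X] (K : SimpleGraph X), Continuous (fun t : ℝ =>
      (∑ u : X, ∑ v : X, if K.dist u v = 0 then (0 : ℝ) else t ^ (K.dist u v - 1)) / 2) := by
    intro X _ K
    apply Continuous.div_const
    apply continuous_finsetSum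
    intro u _
    apply continuous_finsetSum
    intro v _
    split_ifs <;> fun_prop
  have hcontG := hcont G
  have hcontH : Continuous (fun t : ℝ =>
      (∑ u : W, ∑ v : W, if H.dist u v = 0 then (0 : ℝ) else t ^ (H.dist u v - 1)) / 2) := by
    apply Continuous.div_const
    apply continuous_finsetSum
    intro u _
    apply continuous_finsetSum
    intro v _
    split_ifs <;> fun_prop
  have key : ∀ t : ℝ, 0 < t → t < 1 →
      (∑ u : V, ∑ v : V, if G.dist u v = 0 then (0 : ℝ) else t ^ (G.dist u v - 1)) / 2 <
      (∑ u : W, ∑ v : W, if H.dist u v = 0 then (0 : ℝ) else t ^ (H.dist u v - 1)) / 2 := by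
    intro t ht ht1
    have := h t ht ht1
    rw [← tot_div G ht, ← tot_div H ht] at this
    have := lt_of_mul_lt_mul_left this ht.le
    linarith
  have keyc : ∀ t ∈ Set.Icc (0 : ℝ) 1,
      (∑ u : V, ∑ v : V, if G.dist u v = 0 then (0 : ℝ) else t ^ (G.dist u v - 1)) / 2 ≤
      (∑ u : W, ∑ v : W, if H.dist u v = 0 then (0 : ℝ) else t ^ (H.dist u v - 1)) / 2 := by
    intro t htt
    rw [← closure_Ioo (by norm_num : (0 : ℝ) ≠ 1)] at htt
    exact le_on_closure (fun x hx => (key x hx.1 hx.2).le) hcontG.continuousOn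
      hcontH.continuousOn htt
  refine intervalIntegral.integral_lt_integral_of_continuousOn_of_le_of_exists_lt (by norm_num)
    hcontG.continuousOn hcontH.continuousOn (fun t ht => keyc t ⟨ht.1.le, ht.2⟩)
    ⟨1 / 2, by constructor <;> norm_num, key _ (by norm_num) (by norm_num)⟩

lemma harary_iso {V W : Type*} [Fintype V] [Fintype W] {G : SimpleGraph V} {H : SimpleGraph W}
    (e : G ≃g H) : hararyIndex G = hararyIndex H := by
  unfold hararyIndex
  congr 1
  refine Fintype.sum_equiv e.toEquiv _ _ fun u => Fintype.sum_equiv e.toEquiv _ _ fun v => ?_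
  have := dist_iso e u v
  change _ = (1 : ℝ) / (H.dist (e u) (e v) : ℕ)
  rw [this]

/-- Among all graphs with `n` vertices and exactly `k` cut vertices
(`0 ≤ k ≤ n - 2`), the Harary index is maximized by `G_{n,k}`, uniquely up to
isomorphism. -/
theorem harary_le_GNK_of_cutVertices (n k : ℕ) (hk : k + 2 ≤ n) {V : Type*} [Fintype V]
    (G : SimpleGraph V) (hcard : Fintype.card V = n)
    (hcut : {v | IsCutVertex G v}.ncard = k) :
    hararyIndex G ≤ hararyIndex (GNK n k) ∧
      (hararyIndex G = hararyIndex (GNK n k) ↔ Nonempty (G ≃g GNK n k)) := by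
  by_cases hiso : Nonempty (G ≃g GNK n k)
  · obtain ⟨e⟩ := hiso
    have := harary_iso e
    exact ⟨this.le, fun _ => ⟨e⟩, fun _ => this⟩
  · have := harary_lt G (GNK n k) (fun t ht ht1 => tot_main n k hk G hcard hcut hiso ht ht1)
    exact ⟨this.le, fun h => absurd h this.ne, fun h => absurd h hiso⟩
end

section
/- Let n and r be integers with 1 ≤ r ≤ n − 3 and r ≠ n − 4. Let G be a finite simple graph of order n with vertex connectivity exactly r such that G is not isomorphic to K(n−1,r), and such that H(G′) ≤ H(G) for every graph G′ of order n with vertex connectivity exactly r that is not isomorphic to K(n−1,r) (i.e., G attains the second maximum Harary index among graphs of order n with vertex connectivity r). Then G is isomorphic to a graph obtained from K(n−1,r) by deleting one edge of the subgraph K_{n−1} (i.e., one edge not incident with the added vertex). -/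
open SimpleGraph

/-- The graph `K(n-1, r)` on `n` vertices: a complete graph `K_{n-1}` on the first
`n - 1` vertices, together with one extra vertex (the last one) joined to exactly the
first `r` vertices of the `K_{n-1}`. -/
def Knr (n r : ℕ) : SimpleGraph (Fin n) :=
  SimpleGraph.fromRel (fun a b =>
    ((a : ℕ) < n - 1 ∧ (b : ℕ) < n - 1) ∨ ((a : ℕ) = n - 1 ∧ (b : ℕ) < r))

/-- The vertex connectivity of `G`: the least number of vertices whose deletion yields
a disconnected graph or a single vertex. -/
noncomputable def vertexConnectivity {V : Type*} [Fintype V] (G : SimpleGraph V) : ℕ :=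
  sInf {k | ∃ S : Set V, S.ncard = k ∧
    (¬ (G.induce (Sᶜ : Set V)).Connected ∨ (Sᶜ : Set V).ncard = 1)}


section helpers
open Classical

lemma sum_bound {V : Type*} [Fintype V] (G : SimpleGraph V) :
    ∑ u : V, ∑ v : V, ((1/2 : ℝ) - (if u = v then 1/2 else 0) + (if G.Adj u v then 1/2 else 0))
      = (Fintype.card V : ℝ)^2/2 - (Fintype.card V : ℝ)/2 + (G.edgeFinset.card : ℝ) := by
  have h2 : ∑ u : V, ∑ v : V, (if G.Adj u v then (1/2:ℝ) else 0) = (G.edgeFinset.card : ℝ) := by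
    have h := G.sum_degrees_eq_twice_card_edges
    have h3 : ∀ u : V, ∑ v : V, (if G.Adj u v then (1/2:ℝ) else 0) = (G.degree u : ℝ) * (1/2) := by
      intro u
      rw [← Finset.sum_filter, Finset.sum_const, nsmul_eq_mul, ← G.neighborFinset_eq_filter,
        G.card_neighborFinset_eq_degree]
    rw [Finset.sum_congr rfl (fun u _ => h3 u), ← Finset.sum_mul]
    have h' : (∑ u : V, (G.degree u : ℝ)) = 2 * (G.edgeFinset.card : ℝ) := by exact_mod_cast h
    rw [h']; ring
  simp only [Finset.sum_add_distrib, Finset.sum_sub_distrib, h2]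
  simp
  ring

lemma term_le {V : Type*} [Fintype V] (G : SimpleGraph V) (u v : V) :
    (1 : ℝ) / (G.dist u v) ≤
      (1/2 : ℝ) - (if u = v then 1/2 else 0) + (if G.Adj u v then 1/2 else 0) := by
  by_cases h : u = v
  · subst h; simp
  by_cases ha : G.Adj u v
  · rw [SimpleGraph.dist_eq_one_iff_adj.2 ha]; simp [h, ha]; norm_num
  · simp only [h, ha, if_false]
    have h1 : G.dist u v ≠ 1 := fun h => ha (SimpleGraph.dist_eq_one_iff_adj.1 h)
    rcases Nat.lt_or_ge (G.dist u v) 2 with h2 | h2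
    · have : G.dist u v = 0 := by omega
      rw [this]; norm_num
    · have : (2 : ℝ) ≤ G.dist u v := by exact_mod_cast h2
      rw [sub_zero, add_zero]
      exact one_div_le_one_div_of_le (by norm_num) this

lemma term_eq {V : Type*} [Fintype V] (G : SimpleGraph V) (c : V) (hc : ∀ x, x ≠ c → G.Adj c x)
    (u v : V) :
    (1 : ℝ) / (G.dist u v) =
      (1/2 : ℝ) - (if u = v then 1/2 else 0) + (if G.Adj u v then 1/2 else 0) := by
  by_cases h : u = v
  · subst h; simp
  by_cases ha : G.Adj u v
  · rw [SimpleGraph.dist_eq_one_iff_adj.2 ha]; simp [h, ha]; norm_num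
  · have hu : u ≠ c := by rintro rfl; exact ha (hc v (Ne.symm h))
    have hv : v ≠ c := by rintro rfl; exact ha (hc u h).symm
    have h1 : G.dist u v ≠ 1 := fun h => ha (SimpleGraph.dist_eq_one_iff_adj.1 h)
    let w : G.Walk u v := .cons (hc u hu).symm (.cons (hc v hv) .nil)
    have h2 : G.dist u v ≤ 2 := SimpleGraph.dist_le w
    have h3 : 0 < G.dist u v := SimpleGraph.Reachable.pos_dist_of_ne ⟨w⟩ h
    have : G.dist u v = 2 := by omega
    rw [this]; simp [h, ha]

lemma harary_le {V : Type*} [Fintype V] (G : SimpleGraph V) :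
    hararyIndex G ≤
     ((Fintype.card V : ℝ)^2/2 - (Fintype.card V : ℝ)/2 + (G.edgeFinset.card : ℝ))/2 := by
  rw [← sum_bound, hararyIndex]
  gcongr
  exact term_le G _ _

lemma harary_eq {V : Type*} [Fintype V] (G : SimpleGraph V) (c : V)
    (hc : ∀ x, x ≠ c → G.Adj c x) : hararyIndex G =
     ((Fintype.card V : ℝ)^2/2 - (Fintype.card V : ℝ)/2 + (G.edgeFinset.card : ℝ))/2 := by
  rw [← sum_bound, hararyIndex]
  congr 1
  exact Finset.sum_congr rfl fun u _ => Finset.sum_congr rfl fun v _ => term_eq G c hc u v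

lemma card_edges_compl {V : Type*} [Fintype V] (G : SimpleGraph V) :
    G.edgeFinset.card + Gᶜ.edgeFinset.card = (Fintype.card V).choose 2 := by
  rw [← SimpleGraph.card_edgeFinset_top_eq_card_choose_two, ← Finset.card_union_of_disjoint]
  · rw [← SimpleGraph.edgeFinset_sup]
    congr 1
    ext e
    simp only [SimpleGraph.mem_edgeFinset]
    rw [sup_compl_eq_top]
  · exact SimpleGraph.disjoint_edgeFinset.2 disjoint_compl_right

lemma card_compl_ge {V : Type*} [Fintype V] (G : SimpleGraph V) (A B : Finset V)
    (hd : Disjoint A B) (h : ∀ a ∈ A, ∀ b ∈ B, ¬ G.Adj a b) :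
    A.card * B.card ≤ Gᶜ.edgeFinset.card := by
  rw [← Finset.card_product]
  apply Finset.card_le_card_of_injOn (fun p => s(p.1, p.2))
  · rintro ⟨a, b⟩ hp
    simp only [Finset.coe_product, Set.mem_prod, Finset.mem_coe] at hp
    have : a ≠ b := fun hab => Finset.disjoint_left.1 hd hp.1 (hab ▸ hp.2)
    simp [this, h a hp.1 b hp.2]
  · rintro ⟨a, b⟩ hp ⟨c, d⟩ hq heq
    simp only [Finset.coe_product, Set.mem_prod, Finset.mem_coe] at hp hq
    simp only [Sym2.eq_iff] at heq
    rcases heq with ⟨rfl, rfl⟩ | ⟨rfl, rfl⟩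
    · rfl
    · exact absurd hq.2 (Finset.disjoint_left.1 hd hp.1)

lemma knr_adj {n r : ℕ} (a b : Fin n) : (Knr n r).Adj a b ↔ a ≠ b ∧
    (((a : ℕ) < n - 1 ∧ (b : ℕ) < n - 1) ∨ ((a : ℕ) = n - 1 ∧ (b : ℕ) < r) ∨
      ((b : ℕ) = n - 1 ∧ (a : ℕ) < r)) := by
  simp only [Knr, SimpleGraph.fromRel_adj]; tauto

lemma knr_compl_card {n r : ℕ} (hn : r + 3 ≤ n) :
    (Knr n r)ᶜ.edgeFinset.card ≤ n - 1 - r := by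
  let last : Fin n := ⟨n - 1, by omega⟩
  have : (Knr n r)ᶜ.edgeFinset ⊆
      (Finset.Ico r (n-1)).attach.image
        (fun i => s(last, (⟨i.1, by have := Finset.mem_Ico.1 i.2; omega⟩ : Fin n))) := by
    intro e
    induction e using Sym2.ind with
    | _ a b =>
      intro h
      simp only [SimpleGraph.mem_edgeFinset, SimpleGraph.mem_edgeSet, SimpleGraph.compl_adj,
        knr_adj] at h
      obtain ⟨hab, h⟩ := h
      have hab' : (a : ℕ) ≠ b := fun h => hab (Fin.ext h)
      have ha := a.2
      have hb := b.2
      simp only [Finset.mem_image, Finset.mem_attach, true_and, Subtype.exists, Finset.mem_Ico]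
      by_cases h1 : (a : ℕ) = n - 1
      · exact ⟨b, by refine ⟨?_, ?_⟩ <;> grind, congrArg (fun z => s(z, b)) (show last = a from Fin.ext h1.symm)⟩
      · exact ⟨a, by refine ⟨?_, ?_⟩ <;> grind, (congrArg (fun z => s(z, a))
          (show last = b from Fin.ext (by show n - 1 = (b:ℕ); grind))).trans Sym2.eq_swap⟩
  calc _ ≤ _ := Finset.card_le_card this
    _ ≤ _ := Finset.card_image_le
    _ = _ := by simp

lemma conn_le {V : Type*} [Fintype V] (G : SimpleGraph V) (S : Finset V) (v w : V)
    (hv : v ∉ S) (hw : w ∉ S) (hvw : v ≠ w) (h : ∀ x, G.Adj v x → x ∈ S) :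
    vertexConnectivity G ≤ S.card := by
  apply Nat.sInf_le
  refine ⟨(S : Set V), Set.ncard_coe_finset S, Or.inl ?_⟩
  intro hc
  let v' : ((S : Set V)ᶜ : Set V) := ⟨v, by simpa using hv⟩
  let w' : ((S : Set V)ᶜ : Set V) := ⟨w, by simpa using hw⟩
  have : Nontrivial ((S : Set V)ᶜ : Set V) := ⟨v', w', fun h => hvw (congrArg Subtype.val h)⟩
  obtain ⟨x, hx⟩ := hc.preconnected.exists_adj_of_nontrivial v'
  exact x.2 (by simpa using h x.1 hx)

lemma conn_spec {V : Type*} [Fintype V] (G : SimpleGraph V)  :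
    ∃ S : Set V, S.ncard = vertexConnectivity G ∧
    (¬ (G.induce (Sᶜ : Set V)).Connected ∨ (Sᶜ : Set V).ncard = 1) := by
  have : ({k | ∃ S : Set V, S.ncard = k ∧
    (¬ (G.induce (Sᶜ : Set V)).Connected ∨ (Sᶜ : Set V).ncard = 1)}).Nonempty := by
    refine ⟨_, Set.univ, rfl, Or.inl ?_⟩
    intro h
    obtain ⟨x⟩ := h.nonempty
    exact x.2 trivial
  exact Nat.sInf_mem this

/-- a cut splits the graph -/
lemma exists_split {V : Type*} [Fintype V] (G : SimpleGraph V)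
    (h : vertexConnectivity G + 2 ≤ Fintype.card V) :
    ∃ S A B : Finset V, S.card = vertexConnectivity G ∧ Disjoint A B ∧
      A.Nonempty ∧ B.Nonempty ∧ A ∪ B = Sᶜ ∧ ∀ a ∈ A, ∀ b ∈ B, ¬ G.Adj a b := by
  obtain ⟨S, hS, hS'⟩ := conn_spec G
  have hcc : S.ncard + (Sᶜ : Set V).ncard = Fintype.card V := by
    rw [Set.ncard_add_ncard_compl, Nat.card_eq_fintype_card]
  have hnc : ¬ (G.induce (Sᶜ : Set V)).Connected := by
    rcases hS' with h1 | h1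
    · exact h1
    · omega
  have hne : (Sᶜ : Set V).Nonempty := by
    rw [← Set.ncard_pos]; omega
  have : ∃ x y, ¬ (G.induce (Sᶜ : Set V)).Reachable x y := by
    by_contra hcon
    push Not at hcon
    have := hne.to_subtype
    exact hnc ⟨hcon⟩
  obtain ⟨x, y, hxy⟩ := this
  refine ⟨S.toFinset, Finset.univ.filter fun z => ∃ hz : z ∈ Sᶜ,
      (G.induce (Sᶜ : Set V)).Reachable x ⟨z, hz⟩, Finset.univ.filter fun z => ∃ hz : z ∈ Sᶜ,
      ¬ (G.induce (Sᶜ : Set V)).Reachable x ⟨z, hz⟩, ?_, ?_, ?_, ?_, ?_, ?_⟩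
  · rw [← hS, Set.ncard_eq_toFinset_card']
  · rw [Finset.disjoint_left]; simp; grind
  · exact ⟨x, by simpa using (Set.mem_compl_iff S x.1).1 x.2⟩
  · exact ⟨y, by simpa [hxy] using (Set.mem_compl_iff S y.1).1 y.2⟩
  · ext z; simp; grind
  · intro a ha b hb hadj
    simp only [Finset.mem_filter, Finset.mem_univ, true_and] at ha hb
    obtain ⟨ha1, ha2⟩ := ha
    obtain ⟨hb1, hb2⟩ := hb
    apply hb2
    exact ha2.trans (SimpleGraph.Adj.reachable (show (G.induce (Sᶜ : Set V)).Adj ⟨a, ha1⟩ ⟨b, hb1⟩ from hadj))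

lemma conn_ge {V : Type*} [Fintype V] (G : SimpleGraph V) (r : ℕ) (hr : r + 2 ≤ Fintype.card V)
    (U : Finset V) (hU : U.card = r) (h : ∀ u ∈ U, ∀ x, x ≠ u → G.Adj u x) :
    r ≤ vertexConnectivity G := by
  by_contra hlt
  push Not at hlt
  obtain ⟨S, A, B, hS, hd, ⟨a, ha⟩, ⟨b, hb⟩, hAB, hno⟩ := exists_split G (by omega)
  obtain ⟨u, hu, huS⟩ := Finset.exists_mem_notMem_of_card_lt_card (s := S) (t := U) (by omega)
  have : u ∈ A ∪ B := by rw [hAB]; simpa using huS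
  rcases Finset.mem_union.1 this with h1 | h1
  · exact hno u h1 b hb (h u hu b (fun e => Finset.disjoint_left.1 hd h1 (e ▸ hb)))
  · exact hno a ha u h1 (h u hu a (fun e => Finset.disjoint_left.1 hd ha (e ▸ h1))).symm

lemma exists_equiv {V : Type*} [Fintype V] {n r : ℕ} (hcard : Fintype.card V = n) (hn : r + 3 ≤ n)
    (S : Finset V) (hS : S.card = r) (v : V) (hv : v ∉ S) :
    ∃ e : V ≃ Fin n, (e v : ℕ) = n - 1 ∧ ∀ x, (e x : ℕ) < r ↔ x ∈ S := by
  let σ := S.equivFinOfCardEq hS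
  let f : V → Fin n := fun x => if h : x ∈ S then Fin.castLE (by omega) (σ ⟨x, h⟩)
    else ⟨n - 1, by omega⟩
  have hfS : ∀ x (h : x ∈ S), f x = Fin.castLE (by omega) (σ ⟨x, h⟩) := fun x h => dif_pos h
  have hfv : (f v : ℕ) = n - 1 := by simp [f, hv]
  have hlt : ∀ x ∈ S, (f x : ℕ) < r := by
    intro x hx
    rw [hfS x hx]
    exact (σ ⟨x, hx⟩).2
  have hinj : Set.InjOn f (insert v S : Finset V) := by
    intro x hx y hy hxy
    simp only [Finset.coe_insert, Set.mem_insert_iff, Finset.mem_coe] at hx hy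
    rcases hx with rfl | hx <;> rcases hy with rfl | hy
    · rfl
    · have := hlt y hy
      rw [← hxy] at this; omega
    · have := hlt x hx
      rw [hxy] at this; omega
    · rw [hfS x hx, hfS y hy] at hxy
      have := σ.injective (Fin.castLE_injective _ hxy)
      exact congrArg Subtype.val this
  obtain ⟨g, hg⟩ := Finset.exists_equiv_extend_of_card_eq (t := (Finset.univ : Finset (Fin n)))
    (by simpa using hcard) (by simp) hinj
  let e : V ≃ Fin n := g.trans (Equiv.subtypeUnivEquiv (by simp))
  have he : ∀ x ∈ insert v S, e x = f x := fun x hx => hg x hx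
  refine ⟨e, by rw [he v (by simp), hfv], fun x => ⟨fun h => ?_, fun h => ?_⟩⟩
  · let y := σ.symm ⟨e x, h⟩
    have : e x = e y.1 := by
      rw [he y.1 (by simp), hfS y.1 y.2]
      ext
      simp [y]
    rw [e.injective this]; exact y.2
  · rw [he x (by simp [h])]; exact hlt x h

lemma harary_le' {V : Type*} [Fintype V] (G : SimpleGraph V) [Fintype G.edgeSet] :
    hararyIndex G ≤
     ((Fintype.card V : ℝ)^2/2 - (Fintype.card V : ℝ)/2 + (G.edgeFinset.card : ℝ))/2 := by
  convert harary_le G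

lemma harary_eq' {V : Type*} [Fintype V] (G : SimpleGraph V) [Fintype G.edgeSet] (c : V)
    (hc : ∀ x, x ≠ c → G.Adj c x) : hararyIndex G =
     ((Fintype.card V : ℝ)^2/2 - (Fintype.card V : ℝ)/2 + (G.edgeFinset.card : ℝ))/2 := by
  convert harary_eq G c hc

lemma card_edges_compl' {V : Type*} [Fintype V] (G : SimpleGraph V) [Fintype G.edgeSet]
    [Fintype Gᶜ.edgeSet] :
    G.edgeFinset.card + Gᶜ.edgeFinset.card = (Fintype.card V).choose 2 := by
  convert card_edges_compl G

lemma card_compl_ge' {V : Type*} [Fintype V] (G : SimpleGraph V) [Fintype Gᶜ.edgeSet]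
    (A B : Finset V) (hd : Disjoint A B) (h : ∀ a ∈ A, ∀ b ∈ B, ¬ G.Adj a b) :
    A.card * B.card ≤ Gᶜ.edgeFinset.card := by
  convert card_compl_ge G A B hd h

lemma knr_compl_card' {n r : ℕ} [Fintype (Knr n r)ᶜ.edgeSet] (hn : r + 3 ≤ n) :
    (Knr n r)ᶜ.edgeFinset.card ≤ n - 1 - r := by
  convert knr_compl_card hn

end helpers

/-- For `1 ≤ r ≤ n − 3` with `r ≠ n − 4`, a graph attaining the second maximum Harary
index among graphs of order `n` with vertex connectivity `r` is obtained from
`K(n−1, r)` by deleting one edge of the `K_{n-1}` (an edge not incident with the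
added vertex). -/
theorem harary_secondMax_vertexConnectivity (n r : ℕ) (hr : 1 ≤ r) (hrn : r + 3 ≤ n)
    (hrne : r ≠ n - 4)
    {V : Type*} [Fintype V] (G : SimpleGraph V) (hcard : Fintype.card V = n)
    (hconn : vertexConnectivity G = r)
    (hne : ¬ Nonempty (G ≃g Knr n r))
    (hmax : ∀ G' : SimpleGraph (Fin n), vertexConnectivity G' = r →
      ¬ Nonempty (G' ≃g Knr n r) → hararyIndex G' ≤ hararyIndex G) :
    ∃ a b : Fin n, (a : ℕ) < n - 1 ∧ (b : ℕ) < n - 1 ∧ a ≠ b ∧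
      Nonempty (G ≃g (Knr n r).deleteEdges {s(a, b)}) := by
  classical
  -- the comparison graph
  let p : Fin n := ⟨r, by omega⟩
  let q : Fin n := ⟨r + 1, by omega⟩
  let c : Fin n := ⟨0, by omega⟩
  let last : Fin n := ⟨n - 1, by omega⟩
  let G' := (Knr n r).deleteEdges {s(p, q)}
  have hpq : (Knr n r).Adj p q := by
    rw [knr_adj]
    refine ⟨fun h => ?_, Or.inl ⟨?_, ?_⟩⟩
    · have := congrArg Fin.val h
      simp [p, q] at this
    · show r < n - 1; omega
    · show r + 1 < n - 1; omega
  have hedges : G'.edgeFinset.card + 1 = (Knr n r).edgeFinset.card := by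
    have h1 : G'.edgeFinset = (Knr n r).edgeFinset.erase s(p, q) := by
      ext e
      simp [G', SimpleGraph.mem_edgeFinset, SimpleGraph.edgeSet_deleteEdges, and_comm]
    rw [h1]
    exact Finset.card_erase_add_one (by simpa using hpq)
  have huniv : ∀ u : Fin n, (u : ℕ) < r → ∀ x, x ≠ u → G'.Adj u x := by
    intro u hu x hx
    simp only [G', SimpleGraph.deleteEdges_adj, knr_adj, Set.mem_singleton_iff]
    have hx2 := x.2
    refine ⟨⟨hx.symm, ?_⟩, ?_⟩
    · omega
    · intro h
      rw [Sym2.eq_iff] at h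
      rcases h with ⟨h, _⟩ | ⟨h, _⟩ <;>
      · have := congrArg Fin.val h
        simp [p, q] at this
        omega
  have hconn' : vertexConnectivity G' = r := by
    have hUcard : (Finset.univ.filter fun x : Fin n => (x : ℕ) < r).card = r := by
      rw [Fin.card_filter_val_lt]; omega
    apply le_antisymm
    · refine le_trans (conn_le G' (Finset.univ.filter fun x : Fin n => (x : ℕ) < r) last p
        ?_ ?_ ?_ ?_) hUcard.le
      · simp [last]; omega
      · simp [p]
      · intro h
        have := congrArg Fin.val h
        simp [last, p] at this
        omega
      · intro x hx
        have hx := (SimpleGraph.deleteEdges_adj.1 hx).1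
        rw [knr_adj] at hx
        have h1 : (last : ℕ) = n - 1 := rfl
        obtain ⟨hne, hx⟩ := hx
        have : (x : ℕ) ≠ last := fun h => hne (Fin.ext h.symm)
        simp only [Finset.mem_filter, Finset.mem_univ, true_and]
        omega
    · refine conn_ge G' r (by simp; omega) _ hUcard ?_
      intro u hu
      exact huniv u (by simpa using hu)
  have hniso : ¬ Nonempty (G' ≃g Knr n r) := by
    rintro ⟨f⟩
    have := f.card_edgeFinset_eq
    omega
  have hH := hmax G' hconn' hniso
  rw [harary_eq' G' c (huniv c (by show 0 < r; omega))] at hH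
  have hH2 := hH.trans (harary_le' G)
  rw [Fintype.card_fin, hcard] at hH2
  have hE : G'.edgeFinset.card ≤ G.edgeFinset.card := by
    have : (G'.edgeFinset.card : ℝ) ≤ G.edgeFinset.card := by linarith
    exact_mod_cast this
  -- structure of `G`
  obtain ⟨S, A, B, hS, hd, hA, hB, hAB, hno⟩ := exists_split G (by omega)
  rw [hconn] at hS
  have hABc : A.card + B.card = n - r := by
    rw [← Finset.card_union_of_disjoint hd, hAB, Finset.card_compl, hS, hcard]
  have hprod : A.card * B.card ≤ n - r := by
    have h1 := card_compl_ge' G A B hd hno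
    have h2 := card_edges_compl' G
    have h3 := card_edges_compl' (Knr n r)
    have h4 := knr_compl_card' (r := r) hrn
    rw [Fintype.card_fin] at h3
    rw [hcard] at h2
    omega
  have hone : A.card = 1 ∨ B.card = 1 := by
    have ha := hA.card_pos
    have hb := hB.card_pos
    by_contra hcon
    push Not at hcon
    obtain ⟨a, ha'⟩ : ∃ a, A.card = a + 2 := ⟨A.card - 2, by omega⟩
    obtain ⟨b, hb'⟩ : ∃ b, B.card = b + 2 := ⟨B.card - 2, by omega⟩
    rw [ha', hb'] at hprod hABc
    have : (a + 2) * (b + 2) = a * b + 2 * a + 2 * b + 4 := by ring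
    omega
  have hv : ∃ v, v ∉ S ∧ ∀ x, G.Adj v x → x ∈ S := by
    have hmem : ∀ x, x ∉ S → x ∈ A ∨ x ∈ B := by
      intro x hx
      rw [← Finset.mem_union, hAB]; simpa using hx
    rcases hone with h | h
    · obtain ⟨v, rfl⟩ := Finset.card_eq_one.1 h
      refine ⟨v, ?_, ?_⟩
      · have : v ∈ Sᶜ := by rw [← hAB]; simp
        simpa using this
      · intro x hx
        by_contra hxS
        rcases hmem x hxS with h1 | h1
        · rw [Finset.mem_singleton] at h1
          exact hx.ne h1.symm
        · exact hno v (by simp) x h1 hx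
    · obtain ⟨v, rfl⟩ := Finset.card_eq_one.1 h
      refine ⟨v, ?_, ?_⟩
      · have : v ∈ Sᶜ := by rw [← hAB]; simp
        simpa using this
      · intro x hx
        by_contra hxS
        rcases hmem x hxS with h1 | h1
        · exact hno x h1 v (by simp) hx.symm
        · rw [Finset.mem_singleton] at h1
          exact hx.ne h1.symm
  obtain ⟨v, hvS, hvN⟩ := hv
  have hvN' : ∀ x, G.Adj v x ↔ x ∈ S := by
    have hsub : G.neighborFinset v ⊆ S := by
      intro x hx
      exact hvN x (by simpa using hx)
    have hle : S.card ≤ (G.neighborFinset v).card := by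
      obtain ⟨w, hw⟩ : ∃ w, w ∉ insert v S := by
        by_contra hcon
        push Not at hcon
        have h1 : Fintype.card V ≤ (insert v S).card := by
          rw [← Finset.card_univ]
          exact Finset.card_le_card fun x _ => hcon x
        have h2 := Finset.card_insert_le v S
        omega
      rw [Finset.mem_insert, not_or] at hw
      rw [hS, ← hconn]
      exact conn_le G _ v w (by simp) (fun h => hw.2 (hsub h)) (fun h => hw.1 h.symm)
        (fun x hx => by simpa using hx)
    have := Finset.eq_of_subset_of_card_le hsub hle
    intro x
    rw [← this]; simp
  obtain ⟨e, hev, heS⟩ := exists_equiv hcard hrn S hS v hvS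
  have hlast : ∀ x, (e x : ℕ) = n - 1 → x = v := fun x hx => e.injective (Fin.ext (by omega))
  let K : SimpleGraph (Fin n) := G.comap e.symm
  have hK : ∀ a b, K.Adj a b ↔ G.Adj (e.symm a) (e.symm b) := fun a b => Iff.rfl
  let φ : G ≃g K := ⟨e, by intro a b; simp [hK]⟩
  have hKcard : G.edgeFinset.card = K.edgeFinset.card := φ.card_edgeFinset_eq
  have hKlast : ∀ a b : Fin n, (a : ℕ) = n - 1 → (K.Adj a b ↔ (b : ℕ) < r) := by
    intro a b ha
    have : e.symm a = v := hlast _ (by simpa using ha)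
    rw [hK, this, hvN', ← heS, e.apply_symm_apply]
  have hKle : K ≤ Knr n r := by
    intro a b hab
    rw [knr_adj]
    refine ⟨hab.ne, ?_⟩
    by_cases ha : (a : ℕ) = n - 1
    · exact Or.inr (Or.inl ⟨ha, (hKlast a b ha).1 hab⟩)
    by_cases hb : (b : ℕ) = n - 1
    · exact Or.inr (Or.inr ⟨hb, (hKlast b a hb).1 hab.symm⟩)
    have := a.2
    have := b.2
    omega
  have hKsub : K.edgeFinset ⊆ (Knr n r).edgeFinset := SimpleGraph.edgeFinset_subset_edgeFinset.2 hKle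
  have hsd := Finset.card_sdiff_add_card_eq_card hKsub
  have hKne : K ≠ Knr n r := by
    intro h
    exact hne ⟨h ▸ φ⟩
  have hsd1 : ((Knr n r).edgeFinset \ K.edgeFinset).card = 1 := by
    have h0 : ((Knr n r).edgeFinset \ K.edgeFinset).card ≠ 0 := by
      intro h0
      rw [Finset.card_eq_zero, Finset.sdiff_eq_empty_iff_subset] at h0
      exact hKne (le_antisymm hKle (SimpleGraph.edgeFinset_subset_edgeFinset.1 h0))
    omega
  obtain ⟨ed, hed⟩ := Finset.card_eq_one.1 hsd1
  induction ed using Sym2.ind with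
  | _ a b =>
    have hiff : ∀ x y, ((Knr n r).Adj x y ∧ ¬ K.Adj x y) ↔ s(x, y) = s(a, b) := by
      intro x y
      have := congrArg (s(x, y) ∈ ·) hed
      simpa using this
    have hab := (hiff a b).2 rfl
    have hab' := (knr_adj a b).1 hab.1
    have ha : (a : ℕ) ≠ n - 1 := by
      intro ha
      have h1 := hab.2
      rw [hKlast a b ha] at h1
      omega
    have hb : (b : ℕ) ≠ n - 1 := by
      intro hb
      have h1 := hab.2
      rw [K.adj_comm, hKlast b a hb] at h1
      omega
    refine ⟨a, b, by omega, by omega, hab'.1, ?_⟩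
    have : K = (Knr n r).deleteEdges {s(a, b)} := by
      ext x y
      rw [SimpleGraph.deleteEdges_adj, Set.mem_singleton_iff, ← hiff]
      have := @hKle x y
      tauto
    exact ⟨this ▸ φ⟩
end

section
/- Let n ≥ 5 and r = n − 4, with r ≥ 1. Let G be a finite simple graph of order n with vertex connectivity exactly r such that G is not isomorphic to K(n−1,r), and such that H(G′) ≤ H(G) for every graph G′ of order n with vertex connectivity exactly r that is not isomorphic to K(n−1,r) (i.e., G attains the second maximum Harary index among graphs of order n with vertex connectivity r). Then G is isomorphic to G_{2,2,n−4}, or G is isomorphic to a graph obtained from K(n−1,r) by deleting one edge of the subgraph K_{n−1} (i.e., one edge not incident with the added vertex). -/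
open SimpleGraph

/-- Which of the three parts a vertex of `Fin a ⊕ Fin b ⊕ Fin c` lies in. -/
def triPart {a b c : ℕ} : Fin a ⊕ Fin b ⊕ Fin c → ℕ :=
  Sum.elim (fun _ => 0) (Sum.elim (fun _ => 1) (fun _ => 2))

/-- The graph `G_{a,b,c} = (K_a ∪ K_b) ∨ K_c`: the join of the disjoint union of the
complete graphs `K_a` and `K_b` with the complete graph `K_c`. -/
def GJoin (a b c : ℕ) : SimpleGraph (Fin a ⊕ Fin b ⊕ Fin c) :=
  SimpleGraph.fromRel (fun x y =>
    triPart x = triPart y ∨ triPart x = 2 ∨ triPart y = 2)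

/-- Ordered pairs of distinct non-adjacent vertices. -/
noncomputable def nonPairs {V : Type*} [Fintype V] (G : SimpleGraph V) : Finset (V × V) := by
  classical exact Finset.univ.filter (fun p => p.1 ≠ p.2 ∧ ¬ G.Adj p.1 p.2)

lemma mem_nonPairs {V : Type*} [Fintype V] (G : SimpleGraph V) (x y : V) :
    (x, y) ∈ nonPairs G ↔ x ≠ y ∧ ¬ G.Adj x y := by
  simp [nonPairs]

/-- The upper bound weight. -/
noncomputable def wt {V : Type*} (G : SimpleGraph V) (u v : V) : ℝ := by
  classical exact if u = v then 0 else if G.Adj u v then 1 else 1 / 2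

lemma sum_wt {V : Type*} [Fintype V] (G : SimpleGraph V) :
    ∑ u : V, ∑ v : V, wt G u v =
      (Fintype.card V : ℝ) ^ 2 - Fintype.card V - ((nonPairs G).card : ℝ) / 2 := by
  classical
  have h : ∀ u v : V, wt G u v = 1 - (if u = v then 1 else 0) -
      (if u ≠ v ∧ ¬ G.Adj u v then 1 else 0) / 2 := by
    intro u v
    unfold wt
    by_cases h1 : u = v
    · simp [h1]
    · by_cases h2 : G.Adj u v
      · simp [h1, h2]
      · simp [h1, h2]; norm_num
  simp_rw [h, Finset.sum_sub_distrib]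
  congr 1
  · congr 1
    · simp [sq]
    · simp
  · simp_rw [← Finset.sum_div]
    congr 1
    rw [← Fintype.sum_prod_type' (f := fun u v => if u ≠ v ∧ ¬ G.Adj u v then (1 : ℝ) else 0)]
    rw [Finset.sum_boole]
    unfold nonPairs
    congr

lemma inv_dist_le {V : Type*} (G : SimpleGraph V) (u v : V) :
    (1 : ℝ) / (G.dist u v) ≤ wt G u v := by
  classical
  unfold wt
  split_ifs with h1 h2
  · simp [h1]
  · simp [SimpleGraph.dist_eq_one_iff_adj.2 h2]
  · have h : G.dist u v ≠ 1 := fun h => h2 (SimpleGraph.dist_eq_one_iff_adj.1 h)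
    rcases Nat.eq_zero_or_pos (G.dist u v) with h0 | h0
    · rw [h0]; norm_num
    · have : 2 ≤ G.dist u v := by omega
      have : (2 : ℝ) ≤ G.dist u v := by exact_mod_cast this
      exact one_div_le_one_div_of_le (by norm_num) this

lemma wt_le_inv_dist {V : Type*} (G : SimpleGraph V) (z : V)
    (hz : ∀ w, w ≠ z → G.Adj w z) (u v : V) :
    wt G u v ≤ (1 : ℝ) / (G.dist u v) := by
  classical
  unfold wt
  split_ifs with h1 h2
  · simp [h1]
  · simp [SimpleGraph.dist_eq_one_iff_adj.2 h2]
  · have hu : u ≠ z := by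
      rintro rfl; exact h2 (hz v (Ne.symm h1)).symm
    have hv : v ≠ z := by
      rintro rfl; exact h2 (hz u h1)
    let w : G.Walk u v := Walk.cons (hz u hu) (Walk.cons (hz v hv).symm Walk.nil)
    have hw : G.dist u v ≤ 2 := SimpleGraph.dist_le w
    have hp : 0 < G.dist u v := Reachable.pos_dist_of_ne ⟨w⟩ h1
    have : (G.dist u v : ℝ) ≤ 2 := by exact_mod_cast hw
    exact one_div_le_one_div_of_le (by exact_mod_cast hp) this

lemma not_connected_of_sep {V : Type*} (G : SimpleGraph V) (C : Set V) (P : V → Prop)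
    (hP : ∀ a ∈ C, ∀ b ∈ C, P a → ¬ P b → ¬ G.Adj a b)
    (x y : V) (hx : x ∈ C) (hy : y ∈ C) (hPx : P x) (hPy : ¬ P y) :
    ¬ (G.induce C).Connected := by
  intro h
  obtain ⟨w⟩ := h.preconnected ⟨x, hx⟩ ⟨y, hy⟩
  have key : ∀ (a b : C), (G.induce C).Walk a b → P a → P b := by
    intro a b w
    induction w with
    | nil => exact id
    | @cons u v _ hadj _ ih =>
      intro hu
      apply ih
      by_contra hv
      exact hP u u.2 v v.2 hu hv hadj
  exact hPy (key _ _ w hPx)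

lemma exists_equiv_four {V W : Type*} [Fintype V] [Fintype W]
    (h : Fintype.card V = Fintype.card W) (f : Fin 4 ↪ V) (g : Fin 4 ↪ W) :
    ∃ e : V ≃ W, ∀ i, e (f i) = g i := by
  have e0 := Fintype.equivOfCardEq h
  obtain ⟨p, hp⟩ := (Equiv.Perm.isMultiplyPretransitive W 4).exists_smul_eq
    (f.trans e0.toEmbedding) g
  refine ⟨e0.trans p, fun i => ?_⟩
  have := DFunLike.congr_fun hp i
  simpa using this

lemma exists_equiv4 {V W : Type*} [Fintype V] [Fintype W]
    (h : Fintype.card V = Fintype.card W) (a b c d : V) (a' b' c' d' : W)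
    (hf : [a, b, c, d].Nodup) (hg : [a', b', c', d'].Nodup) :
    ∃ e : V ≃ W, e a = a' ∧ e b = b' ∧ e c = c' ∧ e d = d' := by
  obtain ⟨e, he⟩ := exists_equiv_four h ⟨[a, b, c, d].get, List.nodup_iff_injective_get.1 hf⟩
    ⟨[a', b', c', d'].get, List.nodup_iff_injective_get.1 hg⟩
  exact ⟨e, he 0, he 1, he 2, he 3⟩

lemma vc_le {V : Type*} [Fintype V] (G : SimpleGraph V) (C : Set V)
    (h : ¬ (G.induce C).Connected) : vertexConnectivity G + C.ncard ≤ Fintype.card V := by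
  have h1 : vertexConnectivity G ≤ (Cᶜ : Set V).ncard := by
    apply Nat.sInf_le
    refine ⟨Cᶜ, rfl, Or.inl ?_⟩
    rw [compl_compl]; exact h
  have h2 := Set.ncard_add_ncard_compl C
  rw [Nat.card_eq_fintype_card] at h2
  omega

/-- The witness: `G_{2,2,n-4}` on `Fin n`. -/
def wit (n : ℕ) : SimpleGraph (Fin n) where
  Adj x y := x ≠ y ∧ ¬ ((x : ℕ) < 2 ∧ 2 ≤ (y : ℕ) ∧ (y : ℕ) < 4) ∧
    ¬ ((y : ℕ) < 2 ∧ 2 ≤ (x : ℕ) ∧ (x : ℕ) < 4)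
  symm := ⟨by intro x y h; exact ⟨h.1.symm, h.2.2, h.2.1⟩⟩
  loopless := ⟨by intro x h; exact h.1 rfl⟩

lemma wit_univ (n : ℕ) (z w : Fin n) (hz : 4 ≤ (z : ℕ)) (h : w ≠ z) : (wit n).Adj w z := by
  refine ⟨h, ?_, ?_⟩ <;> omega

lemma wit_vc (n : ℕ) (hn : 5 ≤ n) : vertexConnectivity (wit n) = n - 4 := by
  apply le_antisymm
  · let f : Fin 4 → Fin n := Fin.castLE (by omega)
    have h := vc_le (wit n) (Set.range f) (not_connected_of_sep _ _ (fun x => (x : ℕ) < 2)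
      (by
        rintro _ ⟨a, rfl⟩ _ ⟨b, rfl⟩ ha hb hadj
        simp only [f, Fin.val_castLE] at ha hb
        exact hadj.2.1 ⟨ha, by simp only [f, Fin.val_castLE]; omega,
          by simp only [f, Fin.val_castLE]; omega⟩)
      (f 0) (f 2) ⟨_, rfl⟩ ⟨_, rfl⟩ (by simp [f]) (by simp [f]))
    rw [Set.ncard_range_of_injective (Fin.castLE_injective _)] at h
    simp at h
    omega
  · apply le_csInf
    · exact ⟨_, {(⟨0, by omega⟩ : Fin n)}ᶜ, rfl, Or.inr (by rw [compl_compl]; simp)⟩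
    · rintro k ⟨S, rfl, hS⟩
      by_contra hlt
      have h2 := Set.ncard_add_ncard_compl S
      simp only [Nat.card_eq_fintype_card, Fintype.card_fin] at h2
      rcases hS with hS | hS
      · apply hS
        have : ∃ z ∈ Sᶜ, 4 ≤ (z : ℕ) := by
          by_contra hcon
          push Not at hcon
          have hsub : Sᶜ ⊆ Set.range (Fin.castLE (by omega : 4 ≤ n)) := by
            intro z hz
            exact ⟨⟨z, hcon z hz⟩, by ext; simp⟩
          have := Set.ncard_le_ncard hsub
          rw [Set.ncard_range_of_injective (Fin.castLE_injective _)] at this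
          simp at this
          omega
        obtain ⟨z, hz, hz4⟩ := this
        have hr : ∀ w : (Sᶜ : Set (Fin n)), ((wit n).induce Sᶜ).Reachable w ⟨z, hz⟩ := by
          intro w
          by_cases hw : (w : Fin n) = z
          · have : w = ⟨z, hz⟩ := Subtype.ext hw
            rw [this]
          · apply Adj.reachable
            exact wit_univ n z w hz4 hw
        have : Nonempty (Sᶜ : Set (Fin n)) := ⟨⟨z, hz⟩⟩
        exact ⟨fun a b => (hr a).trans (hr b).symm⟩
      · omega

lemma Knr_adj_iff (n : ℕ) (hn : 5 ≤ n) (x y : Fin n) : (Knr n (n - 4)).Adj x y ↔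
    x ≠ y ∧ ¬ ((x : ℕ) = n - 1 ∧ n - 4 ≤ (y : ℕ)) ∧ ¬ ((y : ℕ) = n - 1 ∧ n - 4 ≤ (x : ℕ)) := by
  unfold Knr
  rw [SimpleGraph.fromRel_adj]
  have := x.2
  have := y.2
  rw [ne_eq, Fin.ext_iff]
  omega

lemma wit_not_iso (n : ℕ) (hn : 5 ≤ n) : ¬ Nonempty (wit n ≃g Knr n (n - 4)) := by
  rintro ⟨e⟩
  obtain ⟨g, hg, hadj⟩ : ∃ g : Fin n → Fin n, Function.Injective g ∧
      ∀ x y, (wit n).Adj (g x) (g y) ↔ (Knr n (n - 4)).Adj x y :=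
    ⟨e.symm, e.symm.injective, fun x y => e.symm.map_adj_iff⟩
  let a : Fin n := ⟨n - 1, by omega⟩
  let b : Fin n := ⟨n - 2, by omega⟩
  let c : Fin n := ⟨n - 3, by omega⟩
  let d : Fin n := ⟨n - 4, by omega⟩
  have key : ∀ i : Fin n, n - 4 ≤ (i : ℕ) → ¬ (wit n).Adj (g a) (g i) := by
    intro i hi h
    rw [hadj, Knr_adj_iff n hn] at h
    exact h.2.1 ⟨rfl, hi⟩
  have ne : ∀ i j : Fin n, (i : ℕ) ≠ j → (g i : ℕ) ≠ (g j : ℕ) := by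
    intro i j hij h
    exact hij (congrArg _ (hg (Fin.ext h)))
  have k1 := key b (by simp only [b]; omega)
  have k2 := key c (by simp only [c]; omega)
  have k3 := key d (by simp only [d]; omega)
  have n1 := ne b c (by simp only [b, c]; omega)
  have n2 := ne b d (by simp only [b, d]; omega)
  have n3 := ne c d (by simp only [c, d]; omega)
  have n4 := ne a b (by simp only [a, b]; omega)
  have n5 := ne a c (by simp only [a, c]; omega)
  have n6 := ne a d (by simp only [a, d]; omega)
  generalize g a = a' at *
  generalize g b = b' at *
  generalize g c = c' at *
  generalize g d = d' at *
  simp only [wit, ne_eq, Fin.ext_iff] at k1 k2 k3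
  omega

lemma wit_nonPairs (n : ℕ) (hn : 5 ≤ n) : (nonPairs (wit n)).card ≤ 8 := by
  let a : Fin n := ⟨0, by omega⟩
  let b : Fin n := ⟨1, by omega⟩
  let c : Fin n := ⟨2, by omega⟩
  let d : Fin n := ⟨3, by omega⟩
  have : nonPairs (wit n) ⊆ ({(a, c), (a, d), (b, c), (b, d), (c, a), (d, a), (c, b), (d, b)} :
      Finset (Fin n × Fin n)) := by
    rintro ⟨x, y⟩ h
    rw [mem_nonPairs] at h
    simp only [wit, ne_eq, Fin.ext_iff] at h
    simp only [Finset.mem_insert, Finset.mem_singleton, Prod.mk.injEq, a, b, c, d, Fin.ext_iff]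
    omega
  refine (Finset.card_le_card this).trans ((Finset.card_insert_le _ _).trans
    (Nat.succ_le_succ ((Finset.card_insert_le _ _).trans (Nat.succ_le_succ Finset.card_le_six))))

lemma nonPairs_le (n : ℕ) (hn : 5 ≤ n)
    {V : Type*} [Fintype V] (G : SimpleGraph V) (hcard : Fintype.card V = n)
    (h : hararyIndex (wit n) ≤ hararyIndex G) : (nonPairs G).card ≤ 8 := by
  have h1 : ∑ u, ∑ v, wt (wit n) u v ≤ ∑ u, ∑ v, (1 : ℝ) / ((wit n).dist u v) :=
    Finset.sum_le_sum fun u _ => Finset.sum_le_sum fun v _ =>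
      wt_le_inv_dist _ ⟨4, by omega⟩ (fun w hw => wit_univ n _ w (by simp) hw) u v
  have h2 : ∑ u, ∑ v, (1 : ℝ) / (G.dist u v) ≤ ∑ u, ∑ v, wt G u v :=
    Finset.sum_le_sum fun u _ => Finset.sum_le_sum fun v _ => inv_dist_le G u v
  rw [sum_wt] at h1 h2
  have h3 : ((nonPairs (wit n)).card : ℝ) ≤ 8 := by exact_mod_cast wit_nonPairs n hn
  unfold hararyIndex at h
  rw [Fintype.card_fin] at h1
  rw [hcard] at h2
  have : ((nonPairs G).card : ℝ) ≤ 8 := by linarith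
  exact_mod_cast this

set_option maxHeartbeats 1000000 in
/-- Case 1 + 3. -/
lemma case_one (n : ℕ) (hn : 5 ≤ n)
    {V : Type*} [Fintype V] (G : SimpleGraph V) (hcard : Fintype.card V = n)
    (hconn : vertexConnectivity G = n - 4)
    (hne : ¬ Nonempty (G ≃g Knr n (n - 4))) (hD : (nonPairs G).card ≤ 8)
    (v p q r : V) (hnd : [v, p, q, r].Nodup)
    (hp : ¬ G.Adj v p) (hq : ¬ G.Adj v q) (hr : ¬ G.Adj v r) :
    ∃ a b : Fin n, (a : ℕ) < n - 1 ∧ (b : ℕ) < n - 1 ∧ a ≠ b ∧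
        Nonempty (G ≃g (Knr n (n - 4)).deleteEdges {s(a, b)}) := by
  classical
  obtain ⟨e, ev, ep, eq, er⟩ := exists_equiv4 (W := Fin n) (by simpa using hcard) v p q r
    ⟨n - 1, by omega⟩ ⟨n - 2, by omega⟩ ⟨n - 3, by omega⟩ ⟨n - 4, by omega⟩ hnd
    (by simp; omega)
  have hv1 : ∀ x, (e x : ℕ) = n - 1 ↔ x = v := by
    intro x
    rw [← e.injective.eq_iff, ev, Fin.ext_iff]
  have hp1 : ∀ x, (e x : ℕ) = n - 2 ↔ x = p := by
    intro x
    rw [← e.injective.eq_iff, ep, Fin.ext_iff]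
  have hq1 : ∀ x, (e x : ℕ) = n - 3 ↔ x = q := by
    intro x
    rw [← e.injective.eq_iff, eq, Fin.ext_iff]
  have hr1 : ∀ x, (e x : ℕ) = n - 4 ↔ x = r := by
    intro x
    rw [← e.injective.eq_iff, er, Fin.ext_iff]
  have hge : ∀ x, n - 4 ≤ (e x : ℕ) ↔ x = v ∨ x = p ∨ x = q ∨ x = r := by
    intro x
    rw [← hv1, ← hp1, ← hq1, ← hr1]
    have := (e x).2
    omega
  have hK : ∀ x y, (Knr n (n - 4)).Adj (e x) (e y) ↔ x ≠ y ∧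
      ¬ (x = v ∧ (y = v ∨ y = p ∨ y = q ∨ y = r)) ∧
      ¬ (y = v ∧ (x = v ∨ x = p ∨ x = q ∨ x = r)) := by
    intro x y
    rw [Knr_adj_iff n hn, hv1, hv1, hge, hge, ne_eq, e.injective.eq_iff]
  have hGK : ∀ x y, G.Adj x y → (Knr n (n - 4)).Adj (e x) (e y) := by
    intro x y h
    rw [hK]
    refine ⟨h.ne, ?_, ?_⟩
    · rintro ⟨rfl, rfl | rfl | rfl | rfl⟩
      · exact h.ne rfl
      all_goals contradiction
    · rintro ⟨rfl, rfl | rfl | rfl | rfl⟩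
      · exact h.ne rfl
      all_goals exact absurd h.symm (by assumption)
  have hex : ∃ x y, (Knr n (n - 4)).Adj (e x) (e y) ∧ ¬ G.Adj x y := by
    by_contra hcon
    push Not at hcon
    exact hne ⟨⟨e, fun {x y} => ⟨hcon x y, hGK x y⟩⟩⟩
  obtain ⟨x, y, hxyK, hxy⟩ := hex
  simp only [List.nodup_cons, List.mem_cons, List.not_mem_nil, or_false, not_or,
    not_false_eq_true, List.nodup_nil, and_true] at hnd
  -- neither is v
  have hno : ∀ y, y ≠ v → y ≠ p → y ≠ q → y ≠ r → ¬ G.Adj v y → False := by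
    intro y h1 h2 h3 h4 h5
    have h := vc_le G (({v, p, q, r, y} : Finset V) : Set V)
      (not_connected_of_sep _ _ (fun z => z = v) (by
        rintro a - b hb rfl hbv
        simp only [Finset.coe_insert, Finset.coe_singleton, Set.mem_insert_iff,
          Set.mem_singleton_iff] at hb
        rcases hb with rfl | rfl | rfl | rfl | rfl
        · exact absurd rfl hbv
        all_goals assumption) v y (by simp) (by simp) rfl h1)
    rw [Set.ncard_coe_finset] at h
    have hc : ({v, p, q, r, y} : Finset V).card = 5 := by
      repeat rw [Finset.card_insert_of_notMem (by
        simp only [Finset.mem_insert, Finset.mem_singleton]; grind)]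
      simp
    omega
  have hK' := (hK x y).1 hxyK
  have hxv : x ≠ v := by
    rintro rfl
    exact hno y (by tauto) (by tauto) (by tauto) (by tauto) hxy
  have hyv : y ≠ v := by
    rintro rfl
    exact hno x (by tauto) (by tauto) (by tauto) (by tauto) (fun h => hxy h.symm)
  have hsub : ({(v, p), (v, q), (v, r), (p, v), (q, v), (r, v), (x, y), (y, x)} :
      Finset (V × V)) ⊆ nonPairs G := by
    rintro ⟨s, t⟩ h
    rw [mem_nonPairs]
    simp only [Finset.mem_insert, Finset.mem_singleton, Prod.mk.injEq] at h
    have hs := G.adj_comm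
    rcases h with ⟨rfl, rfl⟩ | ⟨rfl, rfl⟩ | ⟨rfl, rfl⟩ | ⟨rfl, rfl⟩ | ⟨rfl, rfl⟩ | ⟨rfl, rfl⟩ |
      ⟨rfl, rfl⟩ | ⟨rfl, rfl⟩ <;> grind
  have hc : ({(v, p), (v, q), (v, r), (p, v), (q, v), (r, v), (x, y), (y, x)} :
      Finset (V × V)).card = 8 := by
    repeat rw [Finset.card_insert_of_notMem (by
      simp only [Finset.mem_insert, Finset.mem_singleton, Prod.mk.injEq]; grind)]
    simp
  have heq := Finset.eq_of_subset_of_card_le hsub (by omega)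
  refine ⟨e x, e y, ?_, ?_, fun h => hK'.1 (e.injective h), ⟨⟨e, ?_⟩⟩⟩
  · have := (e x).2
    have := mt (hv1 x).1 hxv
    omega
  · have := (e y).2
    have := mt (hv1 y).1 hyv
    omega
  · intro s t
    rw [SimpleGraph.deleteEdges_adj]
    constructor
    · rintro ⟨h1, h2⟩
      by_contra h3
      have hm : (s, t) ∈ nonPairs G := (mem_nonPairs _ _ _).2 ⟨((hK s t).1 h1).1, h3⟩
      rw [← heq] at hm
      have h1 := (hK s t).1 h1
      simp only [Finset.mem_insert, Finset.mem_singleton, Prod.mk.injEq] at hm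
      simp only [Set.mem_singleton_iff, Sym2.eq_iff, e.injective.eq_iff] at h2
      clear heq hc hsub hge hv1 hp1 hq1 hr1 hK hGK hno
      rcases hm with ⟨rfl, rfl⟩ | ⟨rfl, rfl⟩ | ⟨rfl, rfl⟩ | ⟨rfl, rfl⟩ | ⟨rfl, rfl⟩ | ⟨rfl, rfl⟩ |
        ⟨rfl, rfl⟩ | ⟨rfl, rfl⟩ <;> simp at h1 h2
    · intro h
      refine ⟨hGK _ _ h, ?_⟩
      simp only [Set.mem_singleton_iff, Sym2.eq_iff, e.injective.eq_iff]
      rintro (⟨rfl, rfl⟩ | ⟨rfl, rfl⟩)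
      · exact hxy h
      · exact hxy h.symm

lemma GJoin_adj (m : ℕ) (x y : Fin 2 ⊕ Fin 2 ⊕ Fin m) : (GJoin 2 2 m).Adj x y ↔
    x ≠ y ∧ (triPart x = triPart y ∨ triPart x = 2 ∨ triPart y = 2) := by
  unfold GJoin
  rw [SimpleGraph.fromRel_adj]
  have : triPart y = triPart x ↔ triPart x = triPart y := eq_comm
  tauto

set_option maxHeartbeats 1000000 in
/-- Case 2 + 2. -/
lemma case_two (n : ℕ) (hn : 5 ≤ n)
    {V : Type*} [Fintype V] (G : SimpleGraph V) (hcard : Fintype.card V = n)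
    (hD : (nonPairs G).card ≤ 8)
    (a b c d : V) (hnd : [a, b, c, d].Nodup)
    (h1 : ¬ G.Adj a c) (h2 : ¬ G.Adj a d) (h3 : ¬ G.Adj b c) (h4 : ¬ G.Adj b d) :
    Nonempty (G ≃g GJoin 2 2 (n - 4)) := by
  classical
  obtain ⟨e, ea, eb, ec, ed⟩ := exists_equiv4 (W := Fin 2 ⊕ Fin 2 ⊕ Fin (n - 4))
    (by simp [hcard]; omega) a b c d
    (Sum.inl 0) (Sum.inl 1) (Sum.inr (Sum.inl 0)) (Sum.inr (Sum.inl 1)) hnd (by simp)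
  have t0 : ∀ x, triPart (e x) = 0 ↔ x = a ∨ x = b := by
    intro x
    rw [← e.injective.eq_iff, ← e.injective.eq_iff (b := b), ea, eb]
    rcases e x with i | i | i
    · fin_cases i <;> simp [triPart]
    · simp [triPart]
    · simp [triPart]
  have t1 : ∀ x, triPart (e x) = 1 ↔ x = c ∨ x = d := by
    intro x
    rw [← e.injective.eq_iff, ← e.injective.eq_iff (b := d), ec, ed]
    rcases e x with i | i | i
    · simp [triPart]
    · fin_cases i <;> simp [triPart]
    · simp [triPart]
  have t2 : ∀ x, triPart (e x) = 0 ∨ triPart (e x) = 1 ∨ triPart (e x) = 2 := by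
    intro x
    rcases e x with i | i | i <;> simp [triPart]
  simp only [List.nodup_cons, List.mem_cons, List.not_mem_nil, or_false, not_or,
    not_false_eq_true, List.nodup_nil, and_true] at hnd
  have hsub : ({(a, c), (a, d), (b, c), (b, d), (c, a), (d, a), (c, b), (d, b)} :
      Finset (V × V)) ⊆ nonPairs G := by
    rintro ⟨s, t⟩ h
    rw [mem_nonPairs]
    simp only [Finset.mem_insert, Finset.mem_singleton, Prod.mk.injEq] at h
    have hs := G.adj_comm
    rcases h with ⟨rfl, rfl⟩ | ⟨rfl, rfl⟩ | ⟨rfl, rfl⟩ | ⟨rfl, rfl⟩ | ⟨rfl, rfl⟩ | ⟨rfl, rfl⟩ |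
      ⟨rfl, rfl⟩ | ⟨rfl, rfl⟩ <;> grind
  have hc : ({(a, c), (a, d), (b, c), (b, d), (c, a), (d, a), (c, b), (d, b)} :
      Finset (V × V)).card = 8 := by
    repeat rw [Finset.card_insert_of_notMem (by
      simp only [Finset.mem_insert, Finset.mem_singleton, Prod.mk.injEq]; grind)]
    simp
  have heq := Finset.eq_of_subset_of_card_le hsub (by omega)
  have hN : ∀ s t, (s ≠ t ∧ ¬ G.Adj s t) ↔ ((s = a ∨ s = b) ∧ (t = c ∨ t = d)) ∨
      ((s = c ∨ s = d) ∧ (t = a ∨ t = b)) := by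
    intro s t
    rw [← mem_nonPairs, ← heq]
    simp only [Finset.mem_insert, Finset.mem_singleton, Prod.mk.injEq]
    clear heq hc hsub t0 t1 t2 hnd
    constructor
    · rintro (⟨rfl, rfl⟩ | ⟨rfl, rfl⟩ | ⟨rfl, rfl⟩ | ⟨rfl, rfl⟩ | ⟨rfl, rfl⟩ | ⟨rfl, rfl⟩ |
        ⟨rfl, rfl⟩ | ⟨rfl, rfl⟩) <;> simp
    · rintro (⟨rfl | rfl, rfl | rfl⟩ | ⟨rfl | rfl, rfl | rfl⟩) <;> simp
  refine ⟨⟨e, ?_⟩⟩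
  intro s t
  rw [GJoin_adj, ne_eq, e.injective.eq_iff]
  have hN := hN s t
  rw [← t0, ← t0, ← t1, ← t1] at hN
  have hs := t2 s
  have ht := t2 t
  have hne : G.Adj s t → s ≠ t := fun h => h.ne
  by_cases hA : G.Adj s t <;> by_cases hst : s = t
  · exact absurd hst (hne hA)
  · simp only [hA, hst, not_true_eq_false, and_false, false_iff, not_false_eq_true, true_and,
      iff_true] at hN ⊢
    omega
  · simp [hst]
  · simp only [hA, hst, ne_eq, not_false_eq_true, true_and, and_self, true_iff, iff_false]
      at hN ⊢
    omega

/-- For `n ≥ 5` and `r = n − 4`, a graph attaining the second maximum Harary index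
among graphs of order `n` with vertex connectivity `n − 4` is either `G_{2,2,n-4}`
or is obtained from `K(n−1, r)` by deleting one edge of the `K_{n-1}` (an edge not
incident with the added vertex). -/
theorem harary_secondMax_vertexConnectivity_nsub4 (n : ℕ) (hn : 5 ≤ n)
    {V : Type*} [Fintype V] (G : SimpleGraph V) (hcard : Fintype.card V = n)
    (hconn : vertexConnectivity G = n - 4)
    (hne : ¬ Nonempty (G ≃g Knr n (n - 4)))
    (hmax : ∀ G' : SimpleGraph (Fin n), vertexConnectivity G' = n - 4 →
      ¬ Nonempty (G' ≃g Knr n (n - 4)) → hararyIndex G' ≤ hararyIndex G) :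
    Nonempty (G ≃g GJoin 2 2 (n - 4)) ∨
      ∃ a b : Fin n, (a : ℕ) < n - 1 ∧ (b : ℕ) < n - 1 ∧ a ≠ b ∧
        Nonempty (G ≃g (Knr n (n - 4)).deleteEdges {s(a, b)}) := by
  classical
  have hD := nonPairs_le n hn G hcard (hmax _ (wit_vc n hn) (wit_not_iso n hn))
  have hmem : vertexConnectivity G ∈ {k | ∃ S : Set V, S.ncard = k ∧
      (¬ (G.induce (Sᶜ : Set V)).Connected ∨ (Sᶜ : Set V).ncard = 1)} := by
    apply Nat.sInf_mem
    apply Nat.nonempty_of_pos_sInf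
    change 0 < vertexConnectivity G
    omega
  obtain ⟨S, hS, hdis⟩ := hmem
  have hC := Set.ncard_add_ncard_compl S
  rw [Nat.card_eq_fintype_card, hcard] at hC
  have hC4 : (Sᶜ : Set V).ncard = 4 := by omega
  replace hdis : ¬ (G.induce (Sᶜ : Set V)).Connected := by
    rcases hdis with h | h
    · exact h
    · omega
  obtain ⟨z, hz⟩ : (Sᶜ : Set V).Nonempty := by
    apply Set.nonempty_of_ncard_ne_zero; omega
  have : Nonempty (Sᶜ : Set V) := ⟨⟨z, hz⟩⟩
  have hx : ∃ x y, ¬ (G.induce (Sᶜ : Set V)).Reachable x y := by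
    by_contra hcon
    push Not at hcon
    exact hdis ⟨hcon⟩
  obtain ⟨x, y, hxy⟩ := hx
  let A : Finset V := Finset.univ.filter
    (fun w => ∃ h : w ∈ Sᶜ, (G.induce (Sᶜ : Set V)).Reachable x ⟨w, h⟩)
  let B : Finset V := Finset.univ.filter
    (fun w => ∃ h : w ∈ Sᶜ, ¬ (G.induce (Sᶜ : Set V)).Reachable x ⟨w, h⟩)
  have hAB : ∀ a ∈ A, ∀ b ∈ B, a ≠ b ∧ ¬ G.Adj a b := by
    intro a ha b hb
    simp only [A, B, Finset.mem_filter, Finset.mem_univ, true_and] at ha hb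
    obtain ⟨ha, ha'⟩ := ha
    obtain ⟨hb, hb'⟩ := hb
    refine ⟨?_, fun h => hb' (ha'.trans (Adj.reachable (by exact h)))⟩
    rintro rfl
    exact hb' ha'
  have hdisj : Disjoint A B := by
    rw [Finset.disjoint_left]
    intro a ha hb
    exact (hAB a ha a hb).1 rfl
  have hun : ((A ∪ B : Finset V) : Set V) = Sᶜ := by
    ext w
    simp only [A, B, Finset.coe_union, Finset.coe_filter, Finset.mem_univ, true_and,
      Set.mem_union, Set.mem_ofPred_eq]
    constructor
    · rintro (⟨h, -⟩ | ⟨h, -⟩) <;> exact h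
    · intro h
      by_cases hr : (G.induce (Sᶜ : Set V)).Reachable x ⟨w, h⟩
      · exact Or.inl ⟨h, hr⟩
      · exact Or.inr ⟨h, hr⟩
  have hcd : A.card + B.card = 4 := by
    rw [← Finset.card_union_of_disjoint hdisj, ← Set.ncard_coe_finset, hun, hC4]
  have hA0 : 0 < A.card := Finset.card_pos.2 ⟨x, by simp only [A, Finset.mem_filter, Finset.mem_univ, true_and]; exact ⟨x.2, Reachable.refl _⟩⟩
  have hB0 : 0 < B.card := Finset.card_pos.2 ⟨y, by simp only [B, Finset.mem_filter, Finset.mem_univ, true_and]; exact ⟨y.2, hxy⟩⟩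
  have hcases : (A.card = 1 ∧ B.card = 3) ∨ (A.card = 2 ∧ B.card = 2) ∨
      (A.card = 3 ∧ B.card = 1) := by omega
  clear_value A B
  rcases hcases with ⟨h1, h2⟩ | ⟨h1, h2⟩ | ⟨h1, h2⟩
  · right
    obtain ⟨v, rfl⟩ := Finset.card_eq_one.1 h1
    obtain ⟨p, q, r, hpq, hpr, hqr, rfl⟩ := Finset.card_eq_three.1 h2
    have hp := hAB v (by simp) p (by simp)
    have hq := hAB v (by simp) q (by simp)
    have hr := hAB v (by simp) r (by simp)
    exact case_one n hn G hcard hconn hne hD v p q r (by simp; tauto) hp.2 hq.2 hr.2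
  · left
    obtain ⟨a, b, hab, rfl⟩ := Finset.card_eq_two.1 h1
    obtain ⟨c, d, hcd', rfl⟩ := Finset.card_eq_two.1 h2
    have hac := hAB a (by simp) c (by simp)
    have had := hAB a (by simp) d (by simp)
    have hbc := hAB b (by simp) c (by simp)
    have hbd := hAB b (by simp) d (by simp)
    exact case_two n hn G hcard hD a b c d (by simp; tauto) hac.2 had.2 hbc.2 hbd.2
  · right
    obtain ⟨v, rfl⟩ := Finset.card_eq_one.1 h2
    obtain ⟨p, q, r, hpq, hpr, hqr, rfl⟩ := Finset.card_eq_three.1 h1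
    have hp := hAB p (by simp) v (by simp)
    have hq := hAB q (by simp) v (by simp)
    have hr := hAB r (by simp) v (by simp)
    exact case_one n hn G hcard hconn hne hD v p q r
      (by simp; exact ⟨⟨hp.1.symm, hq.1.symm, hr.1.symm⟩, ⟨hpq, hpr⟩, hqr⟩)
      (fun h => hp.2 h.symm) (fun h => hq.2 h.symm) (fun h => hr.2 h.symm)
end
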